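/- arXiv:2103.10117 — 2 statements merged into one kernel-verified Lean document; each statement's English description precedes it below -/
import Mathlib

section
/- Let Υ be a colored quiver. If Υ is monochromatic (|C| = 1) with vertex set I of cardinality n, then there exists a chain of homomorphisms of algebras over B = ⊕_{s∈I} k e_s, namely kῩ = A_n → A_{n−1} → ⋯ → A_1 → A_0 = B(Υ), in which each A_{k−1} is obtained from A_k by localization at a single element. In particular, for an arbitrary colored quiver Υ, the Boalch algebra B(Υ) is a localization of the path algebra kῩ of the double quiver Ῡ. -/
open TensorProduct

namespace NCQP

variable (𝕜 : Type) [Field 𝕜] [CharZero 𝕜]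

/-- A colored quiver on the ordered vertex set `Fin n`: a finite set of colors `C`, the
vertex set `I_c ⊆ I` of each monochromatic subquiver, and the partition of `I_c` into
the parts of the complete multipartite graph, recorded by a labelling `part`. -/
structure ColoredQuiver (n : ℕ) where
  /-- the set of colors -/
  C : Type
  [fintC : Fintype C]
  [decC : DecidableEq C]
  /-- the vertex set `I_c` of the monochromatic subquiver of color `c` -/
  mem : C → Finset (Fin n)
  /-- the part of the partition of `I_c` containing a given vertex -/
  part : C → Fin n → ℕ

attribute [instance] ColoredQuiver.fintC ColoredQuiver.decC

namespace ColoredQuiver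

variable {n : ℕ} (Q : ColoredQuiver n)

/-- There is an arrow of color `c` from `j` to `i` in the colored quiver `Υ`
(one requires `j > i`, both vertices in `I_c`, lying in different parts; edges are
oriented from the larger to the smaller vertex). -/
def Arr (c : Q.C) (i j : Fin n) : Prop :=
  i < j ∧ i ∈ Q.mem c ∧ j ∈ Q.mem c ∧ Q.part c i ≠ Q.part c j

instance (c : Q.C) (i j : Fin n) : Decidable (Q.Arr c i j) := by
  unfold Arr; infer_instance

/-- There is an arrow of color `c` from `j` to `i` in the double `Ῡ`. -/
def DArr (c : Q.C) (i j : Fin n) : Prop :=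
  i ≠ j ∧ i ∈ Q.mem c ∧ j ∈ Q.mem c ∧ Q.part c i ≠ Q.part c j

instance (c : Q.C) (i j : Fin n) : Decidable (Q.DArr c i j) := by
  unfold DArr; infer_instance

end ColoredQuiver

/-- Generators of the path algebra of the extended double `Υ̃` of a colored quiver. -/
inductive BGen (n : ℕ) (C : Type) : Type
  | E : Fin n → BGen n C
  | V : C → Fin n → Fin n → BGen n C
  | W : C → Fin n → Fin n → BGen n C
  | G : C → Fin n → BGen n C
  | Gi : C → Fin n → BGen n C

section BoalchPresentation

variable {n : ℕ} (Q : ColoredQuiver n)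

/-- Shorthands for the generators of the free algebra on `BGen`. -/
noncomputable abbrev bfE (i : Fin n) : FreeAlgebra 𝕜 (BGen n Q.C) :=
  FreeAlgebra.ι 𝕜 (BGen.E i)
noncomputable abbrev bfV (c : Q.C) (i j : Fin n) : FreeAlgebra 𝕜 (BGen n Q.C) :=
  FreeAlgebra.ι 𝕜 (BGen.V c i j)
noncomputable abbrev bfW (c : Q.C) (i j : Fin n) : FreeAlgebra 𝕜 (BGen n Q.C) :=
  FreeAlgebra.ι 𝕜 (BGen.W c i j)
noncomputable abbrev bfG (c : Q.C) (i : Fin n) : FreeAlgebra 𝕜 (BGen n Q.C) :=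
  FreeAlgebra.ι 𝕜 (BGen.G c i)
noncomputable abbrev bfGi (c : Q.C) (i : Fin n) : FreeAlgebra 𝕜 (BGen n Q.C) :=
  FreeAlgebra.ι 𝕜 (BGen.Gi c i)

/-- The idempotent `1_{I_c}` of the subquiver of color `c`. -/
noncomputable def oneIc (c : Q.C) : FreeAlgebra 𝕜 (BGen n Q.C) :=
  ∑ i ∈ Q.mem c, bfE 𝕜 Q i

/-- `v_{c+} = 1_{I_c} + ∑_{i<j} v_{c,ij}`. -/
noncomputable def vcPlus (c : Q.C) : FreeAlgebra 𝕜 (BGen n Q.C) :=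
  oneIc 𝕜 Q c + ∑ p ∈ Finset.univ.filter (fun p : Fin n × Fin n => p.1 < p.2),
    bfV 𝕜 Q c p.1 p.2

/-- `v_{c-} = 1_{I_c} + ∑_{i>j} v_{c,ij}`. -/
noncomputable def vcMinus (c : Q.C) : FreeAlgebra 𝕜 (BGen n Q.C) :=
  oneIc 𝕜 Q c + ∑ p ∈ Finset.univ.filter (fun p : Fin n × Fin n => p.2 < p.1),
    bfV 𝕜 Q c p.1 p.2

/-- `w_{c+} = 1_{I_c} + ∑_{i<j} w_{c,ij}`. -/
noncomputable def wcPlus (c : Q.C) : FreeAlgebra 𝕜 (BGen n Q.C) :=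
  oneIc 𝕜 Q c + ∑ p ∈ Finset.univ.filter (fun p : Fin n × Fin n => p.1 < p.2),
    bfW 𝕜 Q c p.1 p.2

/-- `w_{c-} = 1_{I_c} + ∑_{i>j} w_{c,ij}`. -/
noncomputable def wcMinus (c : Q.C) : FreeAlgebra 𝕜 (BGen n Q.C) :=
  oneIc 𝕜 Q c + ∑ p ∈ Finset.univ.filter (fun p : Fin n × Fin n => p.2 < p.1),
    bfW 𝕜 Q c p.1 p.2

/-- `γ_c = ∑_{i ∈ I_c} γ_{c,i}`. -/
noncomputable def gamC (c : Q.C) : FreeAlgebra 𝕜 (BGen n Q.C) :=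
  ∑ i ∈ Q.mem c, bfG 𝕜 Q c i

/-- The defining relations of the Boalch algebra `B(Υ)`: the path algebra relations of
the extended double `Υ̃`, the local invertibility of the loops `γ_{c,i}`, and the
fission relations `v_{c-} v_{c+} = w_{c+} γ_c w_{c-}`. -/
inductive BoalchRel : FreeAlgebra 𝕜 (BGen n Q.C) → FreeAlgebra 𝕜 (BGen n Q.C) → Prop
  | orth (i j : Fin n) :
      BoalchRel (bfE 𝕜 Q i * bfE 𝕜 Q j) (if i = j then bfE 𝕜 Q i else 0)
  | sum_one : BoalchRel (∑ i : Fin n, bfE 𝕜 Q i) 1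
  | vsupp (c : Q.C) (i j : Fin n) (h : Q.DArr c i j) :
      BoalchRel (bfV 𝕜 Q c i j) (bfE 𝕜 Q i * bfV 𝕜 Q c i j * bfE 𝕜 Q j)
  | vzero (c : Q.C) (i j : Fin n) (h : ¬ Q.DArr c i j) :
      BoalchRel (bfV 𝕜 Q c i j) 0
  | wsupp (c : Q.C) (i j : Fin n) (h : i ≠ j ∧ i ∈ Q.mem c ∧ j ∈ Q.mem c) :
      BoalchRel (bfW 𝕜 Q c i j) (bfE 𝕜 Q i * bfW 𝕜 Q c i j * bfE 𝕜 Q j)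
  | wzero (c : Q.C) (i j : Fin n) (h : ¬ (i ≠ j ∧ i ∈ Q.mem c ∧ j ∈ Q.mem c)) :
      BoalchRel (bfW 𝕜 Q c i j) 0
  | gsupp (c : Q.C) (i : Fin n) (h : i ∈ Q.mem c) :
      BoalchRel (bfG 𝕜 Q c i) (bfE 𝕜 Q i * bfG 𝕜 Q c i * bfE 𝕜 Q i)
  | gzero (c : Q.C) (i : Fin n) (h : i ∉ Q.mem c) :
      BoalchRel (bfG 𝕜 Q c i) 0
  | gisupp (c : Q.C) (i : Fin n) (h : i ∈ Q.mem c) :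
      BoalchRel (bfGi 𝕜 Q c i) (bfE 𝕜 Q i * bfGi 𝕜 Q c i * bfE 𝕜 Q i)
  | gizero (c : Q.C) (i : Fin n) (h : i ∉ Q.mem c) :
      BoalchRel (bfGi 𝕜 Q c i) 0
  | ginv (c : Q.C) (i : Fin n) (h : i ∈ Q.mem c) :
      BoalchRel (bfG 𝕜 Q c i * bfGi 𝕜 Q c i) (bfE 𝕜 Q i)
  | ginv' (c : Q.C) (i : Fin n) (h : i ∈ Q.mem c) :
      BoalchRel (bfGi 𝕜 Q c i * bfG 𝕜 Q c i) (bfE 𝕜 Q i)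
  | main (c : Q.C) :
      BoalchRel (vcMinus 𝕜 Q c * vcPlus 𝕜 Q c)
        (wcPlus 𝕜 Q c * gamC 𝕜 Q c * wcMinus 𝕜 Q c)

/-- The Boalch algebra `B(Υ)` of a colored quiver `Υ`. -/
abbrev Boalch : Type := RingQuot (BoalchRel 𝕜 Q)

/-- The idempotents `e_i ∈ B(Υ)`. -/
noncomputable def bE (i : Fin n) : Boalch 𝕜 Q :=
  RingQuot.mkAlgHom 𝕜 (BoalchRel 𝕜 Q) (bfE 𝕜 Q i)
/-- The arrows `v_{c,ij} ∈ B(Υ)`. -/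
noncomputable def bV (c : Q.C) (i j : Fin n) : Boalch 𝕜 Q :=
  RingQuot.mkAlgHom 𝕜 (BoalchRel 𝕜 Q) (bfV 𝕜 Q c i j)
/-- The arrows `w_{c,ij} ∈ B(Υ)`. -/
noncomputable def bW (c : Q.C) (i j : Fin n) : Boalch 𝕜 Q :=
  RingQuot.mkAlgHom 𝕜 (BoalchRel 𝕜 Q) (bfW 𝕜 Q c i j)
/-- The loops `γ_{c,i} ∈ B(Υ)`. -/
noncomputable def bG (c : Q.C) (i : Fin n) : Boalch 𝕜 Q :=
  RingQuot.mkAlgHom 𝕜 (BoalchRel 𝕜 Q) (bfG 𝕜 Q c i)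
/-- The inverse loops `γ_{c,i}⁻¹ ∈ B(Υ)`. -/
noncomputable def bGi (c : Q.C) (i : Fin n) : Boalch 𝕜 Q :=
  RingQuot.mkAlgHom 𝕜 (BoalchRel 𝕜 Q) (bfGi 𝕜 Q c i)

end BoalchPresentation

/-- Generators of the path algebra of the double `Ῡ` of a colored quiver. -/
inductive DGen (n : ℕ) (C : Type) : Type
  | E : Fin n → DGen n C
  | V : C → Fin n → Fin n → DGen n C

section DoublePresentation

variable {n : ℕ} (Q : ColoredQuiver n)

/-- The defining relations of the path algebra `𝕜Ῡ` of the double of a colored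
quiver. -/
inductive DblRel : FreeAlgebra 𝕜 (DGen n Q.C) → FreeAlgebra 𝕜 (DGen n Q.C) → Prop
  | orth (i j : Fin n) :
      DblRel (FreeAlgebra.ι 𝕜 (DGen.E i) * FreeAlgebra.ι 𝕜 (DGen.E j))
        (if i = j then FreeAlgebra.ι 𝕜 (DGen.E i) else 0)
  | sum_one : DblRel (∑ i : Fin n, FreeAlgebra.ι 𝕜 (DGen.E i)) 1
  | vsupp (c : Q.C) (i j : Fin n) (h : Q.DArr c i j) :
      DblRel (FreeAlgebra.ι 𝕜 (DGen.V c i j))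
        (FreeAlgebra.ι 𝕜 (DGen.E i) * FreeAlgebra.ι 𝕜 (DGen.V c i j) *
          FreeAlgebra.ι 𝕜 (DGen.E j))
  | vzero (c : Q.C) (i j : Fin n) (h : ¬ Q.DArr c i j) :
      DblRel (FreeAlgebra.ι 𝕜 (DGen.V c i j)) 0

/-- The path algebra `𝕜Ῡ` of the double of a colored quiver. -/
abbrev DblPath : Type := RingQuot (DblRel 𝕜 Q)

/-- The idempotents `e_i ∈ 𝕜Ῡ`. -/
noncomputable def dE (i : Fin n) : DblPath 𝕜 Q :=
  RingQuot.mkAlgHom 𝕜 (DblRel 𝕜 Q) (FreeAlgebra.ι 𝕜 (DGen.E i))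
/-- The arrows `v_{c,ij} ∈ 𝕜Ῡ`. -/
noncomputable def dV (c : Q.C) (i j : Fin n) : DblPath 𝕜 Q :=
  RingQuot.mkAlgHom 𝕜 (DblRel 𝕜 Q) (FreeAlgebra.ι 𝕜 (DGen.V c i j))

end DoublePresentation

/-- A `𝕜`-algebra equipped with a distinguished family of `n` idempotents (the images
of the idempotents `e_s` spanning `B = ⊕_s 𝕜 e_s`); homomorphisms of algebras over `B`
are the `𝕜`-algebra maps preserving this family. -/
structure AlgWithIdem (n : ℕ) : Type 1 where
  carrier : Type
  [ring : Ring carrier]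
  [alg : Algebra 𝕜 carrier]
  E : Fin n → carrier

attribute [instance] AlgWithIdem.ring AlgWithIdem.alg

/-- `f : R → S` is the universal localization of `R` at the single element `x`. -/
def IsLocalizationAt {R S : Type} [Ring R] [Algebra 𝕜 R] [Ring S] [Algebra 𝕜 S]
    (f : R →ₐ[𝕜] S) (x : R) : Prop :=
  IsUnit (f x) ∧
    ∀ (C : Type) [Ring C] [Algebra 𝕜 C] (g : R →ₐ[𝕜] C), IsUnit (g x) →
      ∃! h : S →ₐ[𝕜] C, h.comp f = g

/-- There is a chain of homomorphisms of algebras over `B`,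
`𝕜Ῡ = A_m → A_{m-1} → ⋯ → A_1 → A_0 = B(Υ)`, in which each `A_{l-1}` is obtained from
`A_l` by universal localization at a single element. -/
def LocalizationChain {n : ℕ} (Q : ColoredQuiver n) (m : ℕ) : Prop :=
  ∃ (Alg : Fin (m + 1) → AlgWithIdem 𝕜 n)
    (isoTop : (Alg (Fin.last m)).carrier ≃ₐ[𝕜] DblPath 𝕜 Q)
    (isoBot : (Alg 0).carrier ≃ₐ[𝕜] Boalch 𝕜 Q)
    (f : ∀ l : Fin m, (Alg l.succ).carrier →ₐ[𝕜] (Alg l.castSucc).carrier),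
    (∀ i, isoTop ((Alg (Fin.last m)).E i) = dE 𝕜 Q i)
    ∧ (∀ i, isoBot ((Alg 0).E i) = bE 𝕜 Q i)
    ∧ (∀ (l : Fin m) (i : Fin n), f l ((Alg l.succ).E i) = (Alg l.castSucc).E i)
    ∧ (∀ l : Fin m, ∃ x, IsLocalizationAt 𝕜 (f l) x)

section Triangular

variable {A : Type*} [Ring A] {n : ℕ} {ε : Fin n → A}

/-- The sum of the `ε i` over the indices `i ≥ k`. -/
def tailSum (ε : Fin n → A) (k : ℕ) : A :=
  ∑ i : Fin n, if k ≤ i then ε i else 0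

/-- The element which is `tailSum ε k * M * tailSum ε k` on the corner cut out by
`tailSum ε k` and the identity on the complementary corner. -/
def cornerElt (ε : Fin n → A) (M : A) (k : ℕ) : A :=
  1 - tailSum ε k + tailSum ε k * M * tailSum ε k

theorem tailSum_zero (ε : Fin n → A) : tailSum ε 0 = ∑ i, ε i := by
  simp [tailSum]

theorem tailSum_of_le (ε : Fin n → A) {k : ℕ} (hk : n ≤ k) : tailSum ε k = 0 :=
  Finset.sum_eq_zero fun i _ => if_neg (by omega)

theorem tailSum_eq_add (ε : Fin n → A) (i : Fin n) :
    tailSum ε i = ε i + tailSum ε (i + 1) := by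
  have : ε i = ∑ j, if j = i then ε j else 0 := by simp
  rw [tailSum, tailSum, this, ← Finset.sum_add_distrib]
  refine Finset.sum_congr rfl fun j _ => ?_
  rcases lt_trichotomy j i with h | rfl | h
  · rw [if_neg (by simpa using h), if_neg h.ne, if_neg (by simp; omega), add_zero]
  · simp
  · rw [if_pos (by simpa using h.le), if_neg h.ne', if_pos (by simp; omega), zero_add]

theorem map_tailSum {F B : Type*} [Ring B] [FunLike F A B] [RingHomClass F A B] (g : F)
    (ε : Fin n → A) (k : ℕ) : g (tailSum ε k) = tailSum (fun i => g (ε i)) k := by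
  simp [tailSum, apply_ite]

theorem map_cornerElt {F B : Type*} [Ring B] [FunLike F A B] [RingHomClass F A B] (g : F)
    (ε : Fin n → A) (M : A) (k : ℕ) :
    g (cornerElt ε M k) = cornerElt (fun i => g (ε i)) (g M) k := by
  simp [cornerElt, map_tailSum]

theorem idem_mul_tailSum (hε : OrthogonalIdempotents ε) (i : Fin n) (k : ℕ) :
    ε i * tailSum ε k = if k ≤ i then ε i else 0 := by
  rw [tailSum, Finset.mul_sum, Finset.sum_eq_single i]
  · simp [hε.mul_eq]
  · intro j _ hj
    simp [hε.mul_eq, hj.symm]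
  · simp

theorem tailSum_mul_idem (hε : OrthogonalIdempotents ε) (i : Fin n) (k : ℕ) :
    tailSum ε k * ε i = if k ≤ i then ε i else 0 := by
  rw [tailSum, Finset.sum_mul, Finset.sum_eq_single i]
  · simp [hε.mul_eq]
  · intro j _ hj
    simp [hε.mul_eq, hj]
  · simp

theorem tailSum_mul_tailSum (hε : OrthogonalIdempotents ε) (k l : ℕ) :
    tailSum ε k * tailSum ε l = tailSum ε (max k l) := by
  rw [tailSum.eq_1 ε k, Finset.sum_mul, tailSum.eq_1 ε (max k l)]
  refine Finset.sum_congr rfl fun i _ => ?_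
  simp only [ite_mul, zero_mul, idem_mul_tailSum hε, Nat.max_le, ite_and]

theorem tailSum_mul_self (hε : OrthogonalIdempotents ε) (k : ℕ) :
    tailSum ε k * tailSum ε k = tailSum ε k := by
  rw [tailSum_mul_tailSum hε, max_self]

/-- `N` is strictly upper triangular with respect to the orthogonal idempotents `ε`. -/
structure IsStrictUpper (ε : Fin n → A) (N : A) : Prop where
  tailSum_zero_mul : tailSum ε 0 * N = N
  tailSum_mul : ∀ k, tailSum ε k * N = tailSum ε k * N * tailSum ε (k + 1)

/-- `N` is strictly lower triangular with respect to the orthogonal idempotents `ε`. -/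
structure IsStrictLower (ε : Fin n → A) (N : A) : Prop where
  mul_tailSum_zero : N * tailSum ε 0 = N
  mul_tailSum : ∀ k, N * tailSum ε k = tailSum ε (k + 1) * N * tailSum ε k

theorem IsStrictUpper.isNilpotent {N : A} (hN : IsStrictUpper ε N) : IsNilpotent N := by
  have key : ∀ m, N ^ (m + 1) = N ^ (m + 1) * tailSum ε (m + 1) := by
    intro m
    induction m with
    | zero => simpa [hN.tailSum_zero_mul] using hN.tailSum_mul 0
    | succ m ih =>
      calc N ^ (m + 1 + 1) = N ^ (m + 1) * (tailSum ε (m + 1) * N) := by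
            rw [pow_succ, ← mul_assoc, ← ih]
        _ = N ^ (m + 1 + 1) * tailSum ε (m + 1 + 1) := by
            rw [hN.tailSum_mul, ← mul_assoc, ← mul_assoc, ← ih, ← pow_succ]
  exact ⟨n + 1, by rw [key, tailSum_of_le ε (by omega), mul_zero]⟩

theorem IsStrictLower.isNilpotent {N : A} (hN : IsStrictLower ε N) : IsNilpotent N := by
  have key : ∀ m, N ^ (m + 1) = tailSum ε (m + 1) * N ^ (m + 1) := by
    intro m
    induction m with
    | zero => simpa [mul_assoc, hN.mul_tailSum_zero] using hN.mul_tailSum 0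
    | succ m ih =>
      calc N ^ (m + 1 + 1) = N * tailSum ε (m + 1) * N ^ (m + 1) := by
            rw [pow_succ', mul_assoc, ← ih]
        _ = tailSum ε (m + 1 + 1) * N ^ (m + 1 + 1) := by
            rw [hN.mul_tailSum, mul_assoc, ← ih, mul_assoc, ← pow_succ']
  exact ⟨n + 1, by rw [key, tailSum_of_le ε (by omega), zero_mul]⟩

theorem IsStrictUpper.mul_tailSum_zero (hε : OrthogonalIdempotents ε) {N : A}
    (hN : IsStrictUpper ε N) : N * tailSum ε 0 = N := by
  have h := hN.tailSum_mul 0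
  rw [hN.tailSum_zero_mul] at h
  rw [h, mul_assoc, tailSum_mul_tailSum hε]
  rfl

theorem IsStrictLower.tailSum_zero_mul (hε : OrthogonalIdempotents ε) {N : A}
    (hN : IsStrictLower ε N) : tailSum ε 0 * N = N := by
  have h := hN.mul_tailSum 0
  rw [hN.mul_tailSum_zero] at h
  rw [h, ← mul_assoc, ← mul_assoc, tailSum_mul_tailSum hε]
  rfl

theorem IsStrictUpper.tailSum_mul_left (hε : OrthogonalIdempotents ε) {N : A}
    (hN : IsStrictUpper ε N) (k : ℕ) : IsStrictUpper ε (tailSum ε k * N) where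
  tailSum_zero_mul := by rw [← mul_assoc, tailSum_mul_tailSum hε, Nat.zero_max]
  tailSum_mul l := by
    have h := hN.tailSum_mul (max l k)
    have hl := tailSum_mul_tailSum hε l k
    have h' : tailSum ε (max l k) * N =
        tailSum ε (max l k) * N * tailSum ε (max l k + 1) * tailSum ε (l + 1) := by
      rw [mul_assoc _ (tailSum ε _) (tailSum ε _), tailSum_mul_tailSum hε,
        max_eq_left (by omega : l + 1 ≤ max l k + 1), ← h]
    rw [← h] at h'
    rw [← mul_assoc, hl]
    exact h'

theorem IsStrictLower.mul_tailSum_right (hε : OrthogonalIdempotents ε) {N : A}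
    (hN : IsStrictLower ε N) (k : ℕ) : IsStrictLower ε (N * tailSum ε k) where
  mul_tailSum_zero := by rw [mul_assoc, tailSum_mul_tailSum hε, Nat.max_zero]
  mul_tailSum l := by
    have h := hN.mul_tailSum (max k l)
    have h' : N * tailSum ε (max k l) =
        tailSum ε (l + 1) * (tailSum ε (max k l + 1) * N * tailSum ε (max k l)) := by
      rw [← mul_assoc, ← mul_assoc, tailSum_mul_tailSum hε,
        max_eq_right (by omega : l + 1 ≤ max k l + 1), ← h]
    rw [← h] at h'
    rw [mul_assoc, tailSum_mul_tailSum hε, mul_assoc, mul_assoc, tailSum_mul_tailSum hε]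
    exact h'

theorem IsStrictUpper.sum (hε : OrthogonalIdempotents ε) {w : Fin n → Fin n → A}
    (hw : ∀ i j, w i j = ε i * w i j * ε j) :
    IsStrictUpper ε
      (∑ p ∈ Finset.univ.filter (fun p : Fin n × Fin n => p.1 < p.2), w p.1 p.2) where
  tailSum_zero_mul := by
    rw [Finset.mul_sum]
    refine Finset.sum_congr rfl fun p _ => ?_
    rw [hw, ← mul_assoc, ← mul_assoc, tailSum_mul_idem hε, if_pos (Nat.zero_le _)]
  tailSum_mul k := by
    rw [Finset.mul_sum, Finset.sum_mul]
    refine Finset.sum_congr rfl fun p hp => ?_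
    have hp : (p.1 : ℕ) < p.2 := (Finset.mem_filter.1 hp).2
    rw [hw, ← mul_assoc, ← mul_assoc, tailSum_mul_idem hε]
    split_ifs
    · rw [mul_assoc _ (ε p.2), idem_mul_tailSum hε, if_pos (by omega)]
    · simp

theorem IsStrictLower.sum (hε : OrthogonalIdempotents ε) {w : Fin n → Fin n → A}
    (hw : ∀ i j, w i j = ε i * w i j * ε j) :
    IsStrictLower ε
      (∑ p ∈ Finset.univ.filter (fun p : Fin n × Fin n => p.2 < p.1), w p.1 p.2) where
  mul_tailSum_zero := by
    rw [Finset.sum_mul]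
    refine Finset.sum_congr rfl fun p _ => ?_
    rw [hw, mul_assoc, idem_mul_tailSum hε, if_pos (Nat.zero_le _)]
  mul_tailSum k := by
    rw [Finset.sum_mul, Finset.mul_sum, Finset.sum_mul]
    refine Finset.sum_congr rfl fun p hp => ?_
    have hp : (p.2 : ℕ) < p.1 := (Finset.mem_filter.1 hp).2
    rw [hw, mul_assoc (tailSum ε (k + 1)), mul_assoc _ (ε p.2), idem_mul_tailSum hε]
    split_ifs
    · rw [← mul_assoc, ← mul_assoc, tailSum_mul_idem hε, if_pos (by omega)]
    · simp

/-- `M = (1 + N) D (1 + N')` in the corner cut out by `∑ i, ε i`, with `N` strictly upper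
triangular, `N'` strictly lower triangular, and `D` diagonal with inverse `D'`. -/
structure IsUDL (ε : Fin n → A) (M N D D' N' : A) : Prop where
  upper : IsStrictUpper ε N
  lower : IsStrictLower ε N'
  comm : ∀ i, Commute (ε i) D
  comm' : ∀ i, Commute (ε i) D'
  one_mul : tailSum ε 0 * D = D
  one_mul' : tailSum ε 0 * D' = D'
  mul_inv : D * D' = tailSum ε 0
  inv_mul : D' * D = tailSum ε 0
  eq : M = (tailSum ε 0 + N) * D * (tailSum ε 0 + N')

theorem commute_tailSum {D : A} (h : ∀ i, Commute (ε i) D) (k : ℕ) :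
    Commute (tailSum ε k) D := by
  refine Commute.sum_left _ _ _ fun i _ => ?_
  split_ifs
  exacts [h i, Commute.zero_left D]

theorem IsStrictUpper.tailSum_mul_add (hε : OrthogonalIdempotents ε) {N : A}
    (hN : IsStrictUpper ε N) (k : ℕ) :
    tailSum ε k * (tailSum ε 0 + N) = (1 + tailSum ε k * N) * tailSum ε k := by
  have h1 := tailSum_mul_tailSum hε k 0
  have h2 := tailSum_mul_tailSum hε (k + 1) k
  rw [max_eq_left (by omega)] at h1 h2
  rw [mul_add, h1, add_mul, _root_.one_mul, hN.tailSum_mul, mul_assoc _ (tailSum ε (k + 1)), h2]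

theorem IsStrictLower.add_mul_tailSum (hε : OrthogonalIdempotents ε) {N : A}
    (hN : IsStrictLower ε N) (k : ℕ) :
    (tailSum ε 0 + N) * tailSum ε k = tailSum ε k * (1 + N * tailSum ε k) := by
  have h1 := tailSum_mul_tailSum hε 0 k
  have h2 := tailSum_mul_tailSum hε k (k + 1)
  rw [max_eq_right (by omega)] at h1 h2
  rw [add_mul, h1, mul_add, mul_one, hN.mul_tailSum, ← mul_assoc, ← mul_assoc, h2]

theorem IsUDL.isUnit_cornerElt (hε : OrthogonalIdempotents ε) {M N D D' N' : A}
    (h : IsUDL ε M N D D' N') (k : ℕ) : IsUnit (cornerElt ε M k) := by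
  have hp := tailSum_mul_self hε k
  have hD := (commute_tailSum h.comm k).eq
  have hD' := (commute_tailSum h.comm' k).eq
  have hN := h.upper.tailSum_mul k
  have hN' := h.lower.mul_tailSum k
  have hU := h.upper.tailSum_mul_add hε k
  have hL := h.lower.add_mul_tailSum hε k
  have h0 := tailSum_mul_tailSum hε k 0
  have h1 := tailSum_mul_tailSum hε (k + 1) k
  have h2 := tailSum_mul_tailSum hε k (k + 1)
  rw [max_eq_left (by omega)] at h0 h1
  rw [max_eq_right (by omega)] at h2
  have e : tailSum ε k * D * tailSum ε k = tailSum ε k * D := by rw [hD, mul_assoc, hp]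
  have e' : tailSum ε k * D' * tailSum ε k = tailSum ε k * D' := by rw [hD', mul_assoc, hp]
  have hunit : IsUnit (1 - tailSum ε k + tailSum ε k * D) := by
    refine ⟨⟨_, 1 - tailSum ε k + tailSum ε k * D', ?_, ?_⟩, rfl⟩
    · linear_combination (norm := noncomm_ring) hp - hp * D' - e + e * D' +
        tailSum ε k * h.mul_inv + h0
    · linear_combination (norm := noncomm_ring) hp - hp * D - e' + e' * D +
        tailSum ε k * h.inv_mul + h0
  have hNu := (h.upper.tailSum_mul_left hε k).isNilpotent.isUnit_one_add
  have hLu := (h.lower.mul_tailSum_right hε k).isNilpotent.isUnit_one_add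
  have e1 : tailSum ε k * N * (1 - tailSum ε k) = 0 := by
    rw [hN, mul_assoc, mul_sub, h1, mul_one, sub_self, mul_zero]
  have e2 : (1 - tailSum ε k) * (N' * tailSum ε k) = 0 := by
    rw [hN', ← mul_assoc, ← mul_assoc, sub_mul, h2, _root_.one_mul, sub_self, zero_mul, zero_mul]
  have : cornerElt ε M k = (1 + tailSum ε k * N) * (1 - tailSum ε k + tailSum ε k * D) *
      (1 + N' * tailSum ε k) := by
    have : tailSum ε k * M * tailSum ε k = (1 + tailSum ε k * N) * (tailSum ε k * D) *
        (1 + N' * tailSum ε k) := by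
      rw [h.eq, ← mul_assoc, ← mul_assoc, hU, mul_assoc, hL, mul_assoc _ _ D, hD]
      rw [← mul_assoc, mul_assoc _ _ (tailSum ε k), mul_assoc D, hp]
    rw [cornerElt, this]
    linear_combination (norm := noncomm_ring) -e1 * (1 + N' * tailSum ε k) - e2
  rw [this]
  exact (hNu.mul hunit).mul hLu

/-- `y` is inverse to `p * M * p` in the corner cut out by the idempotent `p`. -/
structure IsCornerInv (p M y : A) : Prop where
  left_id : p * y = y
  right_id : y * p = y
  mul_inv : p * M * y = p
  inv_mul : y * M * p = p

theorem exists_isCornerInv (hε : OrthogonalIdempotents ε) {M : A} {k : ℕ}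
    (h : IsUnit (cornerElt ε M k)) : ∃ y, IsCornerInv (tailSum ε k) M y := by
  obtain ⟨u, hu⟩ := h
  have hp := tailSum_mul_self hε k
  rw [cornerElt] at hu
  generalize tailSum ε k = p at *
  have e1 : p * u = p * M * p := by
    rw [hu]
    linear_combination (norm := noncomm_ring) -hp + hp * M * p
  have e2 : u * p = p * M * p := by
    rw [hu]
    linear_combination (norm := noncomm_ring) -hp + p * M * hp
  have hc : p * ↑u⁻¹ = ↑u⁻¹ * p := (Commute.units_inv_right (e1.trans e2.symm)).eq
  refine ⟨p * ↑u⁻¹, ?_, ?_, ?_, ?_⟩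
  · rw [← mul_assoc, hp]
  · rw [hc, mul_assoc, hp]
  · rw [← mul_assoc, ← e1, Units.mul_inv_cancel_right]
  · rw [hc, mul_assoc, mul_assoc, ← mul_assoc p, ← e2, Units.inv_mul_cancel_left]

theorem IsUDL.mul_cornerInv (hε : OrthogonalIdempotents ε) {M N D D' N' : A}
    (h : IsUDL ε M N D D' N') (j : Fin n) {y : A} (hy : IsCornerInv (tailSum ε j) M y) :
    (tailSum ε 0 + N) * ε j = M * y * ε j ∧ ε j * D' = ε j * y * ε j := by
  have hpε : tailSum ε j * ε j = ε j := by rw [tailSum_mul_idem hε, if_pos le_rfl]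
  have hε0 : tailSum ε 0 * ε j = ε j := by rw [tailSum_mul_idem hε, if_pos (Nat.zero_le _)]
  have hε0' : ε j * tailSum ε 0 = ε j := by rw [idem_mul_tailSum hε, if_pos (Nat.zero_le _)]
  have hpε' : tailSum ε (j + 1) * ε j = 0 := by rw [tailSum_mul_idem hε, if_neg (by omega)]
  have hεp' : ε j * tailSum ε (j + 1) = 0 := by rw [idem_mul_tailSum hε, if_neg (by omega)]
  have hD := (commute_tailSum h.comm j).eq
  have hpN : tailSum ε j * N * ε j = 0 := by
    rw [h.upper.tailSum_mul, mul_assoc, hpε', mul_zero]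
  have hNp : ε j * N' * y = 0 := by
    rw [← hy.left_id, mul_assoc, ← mul_assoc N', h.lower.mul_tailSum, ← mul_assoc, ← mul_assoc,
      ← mul_assoc, hεp', zero_mul, zero_mul, zero_mul]
  have hLy : tailSum ε j * ((tailSum ε 0 + N') * y) = (tailSum ε 0 + N') * y := by
    rw [← hy.left_id, ← mul_assoc _ (tailSum ε j), h.lower.add_mul_tailSum hε, ← mul_assoc,
      ← mul_assoc, tailSum_mul_self hε]
  set z := (tailSum ε 0 + N') * y with hz
  have hpUz : tailSum ε j * ((tailSum ε 0 + N) * D * z) = tailSum ε j := by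
    rw [hz, ← mul_assoc _ _ y, ← h.eq, ← mul_assoc, hy.mul_inv]
  have hDz : D * z * ε j = ε j := by
    have hu := (h.upper.tailSum_mul_left hε j).isNilpotent.isUnit_one_add
    have hU := h.upper.tailSum_mul_add hε j
    have hpDz : tailSum ε j * (D * z) = D * z := by rw [← mul_assoc, hD, mul_assoc, hLy]
    have : (1 + tailSum ε j * N) * (D * z) = tailSum ε j := by
      rw [mul_assoc _ D, ← mul_assoc, hU, mul_assoc, hpDz] at hpUz
      exact hpUz
    refine hu.mul_left_cancel ?_
    rw [← mul_assoc, this, hpε, add_mul, hpN, _root_.one_mul, add_zero]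
  constructor
  · rw [h.eq, mul_assoc _ _ y, ← hz, mul_assoc _ D, mul_assoc, hDz]
  · have h1 : D' * ε j = z * ε j := by
      have h0 : tailSum ε 0 * z = z := by
        rw [← hLy, ← mul_assoc, tailSum_mul_tailSum hε, Nat.zero_max]
      calc D' * ε j = D' * (D * z * ε j) := by rw [hDz]
        _ = D' * D * z * ε j := by simp only [mul_assoc]
        _ = z * ε j := by rw [h.inv_mul, h0]
    have h2 : ε j * D' = ε j * D' * ε j := by
      rw [mul_assoc, ← (h.comm' j).eq, ← mul_assoc, (hε.idem j).eq]
    rw [h2, mul_assoc, h1, hz, ← mul_assoc, ← mul_assoc, mul_add, hε0', add_mul, hNp, add_zero]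

theorem IsUDL.unique (hε : OrthogonalIdempotents ε) {M N₁ D₁ D₁' N₁' N₂ D₂ D₂' N₂' : A}
    (h₁ : IsUDL ε M N₁ D₁ D₁' N₁') (h₂ : IsUDL ε M N₂ D₂ D₂' N₂') :
    N₁ = N₂ ∧ D₁ = D₂ ∧ D₁' = D₂' ∧ N₁' = N₂' := by
  have key : ∀ j, N₁ * ε j = N₂ * ε j ∧ ε j * D₁' = ε j * D₂' := by
    intro j
    obtain ⟨y, hy⟩ := exists_isCornerInv hε (h₁.isUnit_cornerElt hε j)
    obtain ⟨hN₁, hD₁⟩ := h₁.mul_cornerInv hε j hy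
    obtain ⟨hN₂, hD₂⟩ := h₂.mul_cornerInv hε j hy
    refine ⟨?_, hD₁.trans hD₂.symm⟩
    simpa [add_mul] using hN₁.trans hN₂.symm
  have hD' : D₁' = D₂' := by
    rw [← h₁.one_mul', ← h₂.one_mul', tailSum_zero, Finset.sum_mul, Finset.sum_mul]
    exact Finset.sum_congr rfl fun j _ => (key j).2
  have hD : D₁ = D₂ := by
    have hc := (commute_tailSum h₁.comm 0).eq
    rw [← h₁.one_mul, hc, ← h₂.inv_mul, ← hD', ← mul_assoc, h₁.mul_inv, h₂.one_mul]
  have hN : N₁ = N₂ := by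
    rw [← h₁.upper.mul_tailSum_zero hε, ← h₂.upper.mul_tailSum_zero hε, tailSum_zero, Finset.mul_sum, Finset.mul_sum]
    exact Finset.sum_congr rfl fun j _ => (key j).1
  refine ⟨hN, hD, hD', ?_⟩
  subst hN hD
  have hu := h₁.upper.isNilpotent.isUnit_one_add
  have e : (tailSum ε 0 + N₁) * D₁ = (1 + N₁) * D₁ := by
    rw [add_mul, add_mul, h₁.one_mul, _root_.one_mul]
  have heq := h₁.eq.symm.trans h₂.eq
  rw [e, mul_assoc, mul_assoc] at heq
  have heq := congrArg (D₁' * ·) (hu.mul_left_cancel heq)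
  simp only [← mul_assoc, h₁.inv_mul] at heq
  rw [mul_add, mul_add, h₁.lower.tailSum_zero_mul hε, h₂.lower.tailSum_zero_mul hε] at heq
  exact add_left_cancel heq

theorem IsUDL.map {B : Type*} [Ring B] (g : A →+* B) {M N D D' N' : A}
    (h : IsUDL ε M N D D' N') :
    IsUDL (fun i => g (ε i)) (g M) (g N) (g D) (g D') (g N') where
  upper := ⟨by rw [← map_tailSum, ← map_mul, h.upper.tailSum_zero_mul], fun k => by
    simp only [← map_tailSum, ← map_mul]; rw [← h.upper.tailSum_mul]⟩
  lower := ⟨by rw [← map_tailSum, ← map_mul, h.lower.mul_tailSum_zero], fun k => by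
    simp only [← map_tailSum, ← map_mul]; rw [← h.lower.mul_tailSum]⟩
  comm i := (h.comm i).map g
  comm' i := (h.comm' i).map g
  one_mul := by rw [← map_tailSum, ← map_mul, h.one_mul]
  one_mul' := by rw [← map_tailSum, ← map_mul, h.one_mul']
  mul_inv := by rw [← map_tailSum, ← map_mul, h.mul_inv]
  inv_mul := by rw [← map_tailSum, ← map_mul, h.inv_mul]
  eq := by simp only [← map_tailSum, ← map_mul, ← map_add]; rw [← h.eq]

theorem IsCornerInv.schurComplement {e q M Y Z : A} (he : e * e = e) (hq : q * q = q)
    (heq : e * q = 0) (hqe : q * e = 0) (hY : IsCornerInv (e + q) M Y)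
    (hZ : IsCornerInv q M Z) :
    (e * M * e - e * M * Z * M * e) * (e * Y * e) = e ∧
      e * Y * e * (e * M * e - e * M * Z * M * e) = e ∧
      Y * (e * M * e - e * M * Z * M * e) * Y = Y - Z := by
  have hZe : Z * e = 0 := by rw [← hZ.right_id, mul_assoc, hqe, mul_zero]
  have heZ : e * Z = 0 := by rw [← hZ.left_id, ← mul_assoc, heq, zero_mul]
  have hep : e * (e + q) = e := by rw [mul_add, he, heq, add_zero]
  have hpe : (e + q) * e = e := by rw [add_mul, he, hqe, add_zero]
  have hqp : q * (e + q) = q := by rw [mul_add, hqe, hq, zero_add]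
  have hpq : (e + q) * q = q := by rw [add_mul, heq, hq, zero_add]
  have hpY : e * Y + q * Y = Y := by rw [← add_mul, hY.left_id]
  have hYp : Y * e + Y * q = Y := by rw [← mul_add, hY.right_id]
  have heMY : e * M * Y = e := by
    rw [← hep, mul_assoc e, mul_assoc e, hY.mul_inv]
  have hYMe : Y * M * e = e := by
    rw [← hpe, ← mul_assoc, hY.inv_mul]
  have hZMY : Z * M * Y = Z := by
    rw [← hZ.right_id, ← hqp, mul_assoc Z, mul_assoc Z, mul_assoc q, mul_assoc q, hY.mul_inv]
  have hYMZ : Y * M * Z = Z := by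
    rw [← hZ.left_id, ← hpq, ← mul_assoc, ← mul_assoc, hY.inv_mul]
  have hA : Z * M * e * Y = Z - q * Y := by
    have : Z * M * q * Y = q * Y := by rw [hZ.inv_mul]
    linear_combination (norm := noncomm_ring) Z * M * hpY + hZMY - this
  have hB : Y * e * M * Z = Z - Y * q := by
    have : Y * q * M * Z = Y * q := by rw [mul_assoc Y, mul_assoc Y, hZ.mul_inv]
    linear_combination (norm := noncomm_ring) hYp * M * Z + hYMZ - this
  refine ⟨?_, ?_, ?_⟩
  · linear_combination (norm := noncomm_ring) e * M * he * Y * e - e * M * Z * M * he * Y * e -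
      e * M * hA * e - e * M * hZe + e * M * hpY * e + heMY * e + he
  · linear_combination (norm := noncomm_ring) e * Y * he * M * e - e * Y * he * M * Z * M * e -
      e * hB * M * e - heZ * M * e + e * hYp * M * e + e * hYMe + he
  · linear_combination (norm := noncomm_ring) -(hB * M * e * Y) + hYp * M * e * Y + hYMe * Y -
      hA + hpY

theorem exists_triangular_factors (hε : OrthogonalIdempotents ε) {M : A}
    (hM : tailSum ε 0 * M * tailSum ε 0 = M) (hx : ∀ k : Fin n, IsUnit (cornerElt ε M k)) :
    ∃ (w : Fin n → Fin n → A) (γ γ' : Fin n → A),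
      (∀ i j, w i j = ε i * w i j * ε j) ∧ (∀ i, w i i = 0) ∧
      (∀ i, γ i = ε i * γ i * ε i) ∧ (∀ i, γ' i = ε i * γ' i * ε i) ∧
      (∀ i, γ i * γ' i = ε i) ∧ (∀ i, γ' i * γ i = ε i) ∧
      M = (tailSum ε 0 +
          ∑ p ∈ Finset.univ.filter (fun p : Fin n × Fin n => p.1 < p.2), w p.1 p.2) *
        (∑ i, γ i) *
        (tailSum ε 0 +
          ∑ p ∈ Finset.univ.filter (fun p : Fin n × Fin n => p.2 < p.1), w p.1 p.2) := by
  have hx' : ∀ k : ℕ, ∃ y, IsCornerInv (tailSum ε k) M y := by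
    intro k
    refine exists_isCornerInv hε ?_
    rcases lt_or_ge k n with hk | hk
    · exact hx ⟨k, hk⟩
    · simp [cornerElt, tailSum_of_le ε hk]
  choose y hy using hx'
  have hε1 (i) : ε i * ε i = ε i := (hε.idem i).eq
  let γ : Fin n → A := fun j => ε j * M * ε j - ε j * M * y (j + 1) * M * ε j
  let γ' : Fin n → A := fun j => ε j * y j * ε j
  have hp (j : Fin n) : IsCornerInv (ε j + tailSum ε (j + 1)) M (y j) := by
    rw [← tailSum_eq_add]
    exact hy j
  have hschur (j : Fin n) := (hp j).schurComplement (hε1 j) (tailSum_mul_self hε _)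
    (by rw [idem_mul_tailSum hε, if_neg (by omega)])
    (by rw [tailSum_mul_idem hε, if_neg (by omega)]) (hy (j + 1))
  have hM0 : tailSum ε 0 * M = M := by
    rw [← hM, ← mul_assoc, ← mul_assoc, tailSum_mul_self hε]
  have hM0' : M * tailSum ε 0 = M := by
    rw [← hM, mul_assoc, tailSum_mul_self hε]
  have hMy (i j : Fin n) (hij : j ≤ i) : ε i * M * y j = ε i := by
    have : ε i * tailSum ε j = ε i := by rw [idem_mul_tailSum hε, if_pos (Fin.le_def.1 hij)]
    rw [← this, mul_assoc (ε i), mul_assoc (ε i), (hy j).mul_inv]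
  have hyM (i j : Fin n) (hij : i ≤ j) : y i * M * ε j = ε j := by
    have : tailSum ε i * ε j = ε j := by rw [tailSum_mul_idem hε, if_pos (Fin.le_def.1 hij)]
    rw [← this, ← mul_assoc, (hy i).inv_mul]
  let w : Fin n → Fin n → A := fun i j =>
    if i < j then ε i * (M * y j) * ε j else if j < i then ε i * (y i * M) * ε j else 0
  have hw (x : A) (i j : Fin n) : ε i * x * ε j = ε i * (ε i * x * ε j) * ε j := by
    simp only [mul_assoc, hε1]
    rw [← mul_assoc (ε i) (ε i), hε1]
  refine ⟨w, γ, γ', fun i j => ?_, fun i => ?_, fun i => ?_, fun i => hw _ i i,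
    fun i => (hschur i).1, fun i => (hschur i).2.1, ?_⟩
  · simp only [w]
    split_ifs
    exacts [hw _ i j, hw _ i j, by simp]
  · simp [w]
  · have : γ i = ε i * (M - M * y (i + 1) * M) * ε i := by
      simp only [γ, mul_sub, sub_mul, mul_assoc]
    rw [this]
    exact hw _ i i
  · have hU : tailSum ε 0 + ∑ p ∈ Finset.univ.filter
        (fun p : Fin n × Fin n => p.1 < p.2), w p.1 p.2 = ∑ j : Fin n, M * y j * ε j := by
      rw [Finset.sum_filter, Fintype.sum_prod_type_right, tailSum_zero, ← Finset.sum_add_distrib]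
      refine Finset.sum_congr rfl fun j _ => ?_
      have e1 : ε j = ∑ i, if i = j then ε i else 0 := by simp
      nth_rw 1 [e1, ← hM0, tailSum_zero, Finset.sum_mul, Finset.sum_mul, Finset.sum_mul,
        ← Finset.sum_add_distrib]
      refine Finset.sum_congr rfl fun i _ => ?_
      rcases lt_or_ge i j with h | h
      · simp [w, h, h.ne, mul_assoc]
      · rw [if_neg h.not_gt, hMy i j h, hε.mul_eq, add_zero]
    have hL : tailSum ε 0 + ∑ p ∈ Finset.univ.filter
        (fun p : Fin n × Fin n => p.2 < p.1), w p.1 p.2 = ∑ j : Fin n, ε j * y j * M := by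
      rw [Finset.sum_filter, Fintype.sum_prod_type, tailSum_zero, ← Finset.sum_add_distrib]
      refine Finset.sum_congr rfl fun i _ => ?_
      have e1 : ε i = ∑ j, if i = j then ε i else 0 := by simp
      nth_rw 1 [e1, ← hM0', tailSum_zero, Finset.mul_sum, Finset.mul_sum,
        ← Finset.sum_add_distrib]
      refine Finset.sum_congr rfl fun j _ => ?_
      rcases lt_or_ge j i with h | h
      · simp [w, h, h.ne', h.not_gt, mul_assoc]
      · rw [if_neg h.not_gt, ← mul_assoc, mul_assoc (ε i), mul_assoc (ε i), hyM i j h, hε.mul_eq,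
          add_zero]
    have hγε (j : Fin n) : ε j * γ j = γ j := by
      simp only [γ, mul_sub, ← mul_assoc, hε1]
    have hγε' (j : Fin n) : γ j * ε j = γ j := by
      simp only [γ, sub_mul, mul_assoc, hε1]
    have hUγ : (∑ j : Fin n, M * y j * ε j) * ∑ j, γ j = ∑ j : Fin n, M * y j * γ j := by
      rw [Finset.sum_mul_sum]
      refine Finset.sum_congr rfl fun i _ => ?_
      rw [Finset.sum_eq_single i]
      · rw [mul_assoc, hγε]
      · intro j _ hj
        rw [← hγε j, mul_assoc, ← mul_assoc (ε i), hε.ortho hj.symm, zero_mul, mul_zero]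
      · simp
    have hUγL : (∑ j : Fin n, M * y j * γ j) * ∑ j : Fin n, ε j * y j * M =
        ∑ j : Fin n, M * (y j - y (j + 1)) * M := by
      rw [Finset.sum_mul_sum]
      refine Finset.sum_congr rfl fun i _ => ?_
      rw [Finset.sum_eq_single i]
      · calc M * y i * γ i * (ε i * y i * M) = M * (y i * (γ i * ε i) * y i) * M := by
              simp only [mul_assoc]
          _ = M * (y i - y (i + 1)) * M := by
              rw [hγε']
              exact congrArg (M * · * M) (hschur i).2.2
      · intro j _ hj
        rw [← hγε' i, mul_assoc, mul_assoc (γ i), mul_assoc (ε j), ← mul_assoc (ε i),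
          hε.ortho hj.symm, zero_mul, mul_zero, mul_zero]
      · simp
    have hyn : y n = 0 := by rw [← (hy n).left_id, tailSum_of_le ε le_rfl, zero_mul]
    have hMyM : M * y 0 * M = M := by
      nth_rw 1 [← hM0]
      rw [(hy 0).mul_inv, hM0]
    rw [hU, hL, hUγ, hUγL, ← Finset.sum_mul, ← Finset.mul_sum,
      Fin.sum_univ_eq_sum_range (fun j => y j - y (j + 1)), Finset.sum_range_sub', hyn, sub_zero,
      hMyM]

theorem IsUDL.of_entries (hε : OrthogonalIdempotents ε) {M : A} {w : Fin n → Fin n → A}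
    {γ γ' : Fin n → A} (hw : ∀ i j, w i j = ε i * w i j * ε j)
    (hγ : ∀ i, γ i = ε i * γ i * ε i) (hγ' : ∀ i, γ' i = ε i * γ' i * ε i)
    (hmul : ∀ i, γ i * γ' i = ε i) (hmul' : ∀ i, γ' i * γ i = ε i)
    (hM : M = (tailSum ε 0 +
          ∑ p ∈ Finset.univ.filter (fun p : Fin n × Fin n => p.1 < p.2), w p.1 p.2) *
        (∑ i, γ i) *
        (tailSum ε 0 +
          ∑ p ∈ Finset.univ.filter (fun p : Fin n × Fin n => p.2 < p.1), w p.1 p.2)) :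
    IsUDL ε M
      (∑ p ∈ Finset.univ.filter (fun p : Fin n × Fin n => p.1 < p.2), w p.1 p.2)
      (∑ i, γ i) (∑ i, γ' i)
      (∑ p ∈ Finset.univ.filter (fun p : Fin n × Fin n => p.2 < p.1), w p.1 p.2) := by
  have hleft {γ : Fin n → A} (hγ : ∀ i, γ i = ε i * γ i * ε i) (i : Fin n) :
      ε i * ∑ j, γ j = γ i := by
    rw [Finset.mul_sum, Finset.sum_eq_single i]
    · rw [hγ, ← mul_assoc, ← mul_assoc, (hε.idem i).eq]
    · intro j _ hj
      rw [hγ, ← mul_assoc, ← mul_assoc, hε.ortho hj.symm, zero_mul, zero_mul]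
    · simp
  have hright {γ : Fin n → A} (hγ : ∀ i, γ i = ε i * γ i * ε i) (i : Fin n) :
      (∑ j, γ j) * ε i = γ i := by
    rw [Finset.sum_mul, Finset.sum_eq_single i]
    · rw [hγ, mul_assoc, (hε.idem i).eq]
    · intro j _ hj
      rw [hγ, mul_assoc, hε.ortho hj, mul_zero]
    · simp
  have hprod {γ γ' : Fin n → A} (hγ : ∀ i, γ i = ε i * γ i * ε i)
      (hγ' : ∀ i, γ' i = ε i * γ' i * ε i) (hmul : ∀ i, γ i * γ' i = ε i) :
      (∑ i, γ i) * ∑ i, γ' i = tailSum ε 0 := by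
    rw [tailSum_zero, Finset.sum_mul]
    refine Finset.sum_congr rfl fun i _ => ?_
    have : γ i = γ i * ε i := by rw [hγ, mul_assoc (ε i * γ i), (hε.idem i).eq]
    rw [this, mul_assoc, hleft hγ', hmul]
  have hone {γ : Fin n → A} (hγ : ∀ i, γ i = ε i * γ i * ε i) :
      tailSum ε 0 * ∑ i, γ i = ∑ i, γ i := by
    rw [tailSum_zero, Finset.sum_mul]
    exact Finset.sum_congr rfl fun i _ => hleft hγ i
  exact ⟨.sum hε hw, .sum hε hw, fun i => (hleft hγ i).trans (hright hγ i).symm,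
    fun i => (hleft hγ' i).trans (hright hγ' i).symm, hone hγ, hone hγ', hprod hγ hγ' hmul,
    hprod hγ' hγ hmul', hM⟩

theorem idem_mul_sum_filter_mul_idem (hε : OrthogonalIdempotents ε) {w : Fin n → Fin n → A}
    (hw : ∀ i j, w i j = ε i * w i j * ε j) (P : Fin n × Fin n → Prop) [DecidablePred P]
    {i j : Fin n} (hP : P (i, j)) :
    ε i * (∑ p ∈ Finset.univ.filter P, w p.1 p.2) * ε j = w i j := by
  rw [Finset.mul_sum, Finset.sum_mul, Finset.sum_eq_single (i, j)]
  · exact (hw i j).symm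
  · rintro ⟨a, b⟩ - hab
    dsimp only
    rw [hw]
    by_cases ha : i = a
    · have hb : b ≠ j := fun h => hab (by rw [ha, h])
      rw [← mul_assoc, mul_assoc _ (ε b), hε.ortho hb, mul_zero]
    · rw [← mul_assoc, ← mul_assoc, hε.ortho ha, zero_mul, zero_mul, zero_mul]
  · simp [hP]

theorem idem_mul_sum_mul_idem (hε : OrthogonalIdempotents ε) {γ : Fin n → A}
    (hγ : ∀ i, γ i = ε i * γ i * ε i) (i : Fin n) : ε i * (∑ j, γ j) * ε i = γ i := by
  rw [Finset.mul_sum, Finset.sum_mul, Finset.sum_eq_single i]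
  · exact (hγ i).symm
  · intro j _ hj
    rw [hγ, ← mul_assoc, ← mul_assoc, hε.ortho hj.symm, zero_mul, zero_mul, zero_mul]
  · simp

end Triangular

section Localization

omit [CharZero 𝕜]

variable {R S T : Type} [Ring R] [Algebra 𝕜 R] [Ring S] [Algebra 𝕜 S] [Ring T] [Algebra 𝕜 T]

/-- `f : R → S` is the universal localization of `R` at the set `X`. -/
def IsLocalizationAtSet (f : R →ₐ[𝕜] S) (X : Set R) : Prop :=
  (∀ x ∈ X, IsUnit (f x)) ∧
    ∀ (C : Type) [Ring C] [Algebra 𝕜 C] (g : R →ₐ[𝕜] C), (∀ x ∈ X, IsUnit (g x)) →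
      ∃! h : S →ₐ[𝕜] C, h.comp f = g

/-- The relations presenting the universal localization of `R` at `X` by the elements of `R`
and formal inverses of the elements of `X`. -/
inductive LocRel (X : Set R) : FreeAlgebra 𝕜 (R ⊕ X) → FreeAlgebra 𝕜 (R ⊕ X) → Prop
  | add (a b : R) : LocRel X (FreeAlgebra.ι 𝕜 (.inl (a + b)))
      (FreeAlgebra.ι 𝕜 (.inl a) + FreeAlgebra.ι 𝕜 (.inl b))
  | mul (a b : R) : LocRel X (FreeAlgebra.ι 𝕜 (.inl (a * b)))
      (FreeAlgebra.ι 𝕜 (.inl a) * FreeAlgebra.ι 𝕜 (.inl b))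
  | algebraMap (r : 𝕜) : LocRel X (FreeAlgebra.ι 𝕜 (.inl (algebraMap 𝕜 R r)))
      (algebraMap 𝕜 _ r)
  | mul_inv (x : X) : LocRel X (FreeAlgebra.ι 𝕜 (.inl x.1) * FreeAlgebra.ι 𝕜 (.inr x)) 1
  | inv_mul (x : X) : LocRel X (FreeAlgebra.ι 𝕜 (.inr x) * FreeAlgebra.ι 𝕜 (.inl x.1)) 1

/-- The universal localization of `R` at `X`. -/
abbrev UnivLoc (X : Set R) : Type := RingQuot (LocRel 𝕜 X)

/-- The structure map of the universal localization. -/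
noncomputable def univLocMap (X : Set R) : R →ₐ[𝕜] UnivLoc 𝕜 X :=
  have hmul (a b : R) := by simpa using RingQuot.mkAlgHom_rel 𝕜 (LocRel.mul (𝕜 := 𝕜) (X := X) a b)
  have hadd (a b : R) := by simpa using RingQuot.mkAlgHom_rel 𝕜 (LocRel.add (𝕜 := 𝕜) (X := X) a b)
  have halg (r : 𝕜) : RingQuot.mkAlgHom 𝕜 (LocRel 𝕜 X)
      (FreeAlgebra.ι 𝕜 (.inl (algebraMap 𝕜 R r))) = algebraMap 𝕜 _ r := by
    rw [RingQuot.mkAlgHom_rel 𝕜 (LocRel.algebraMap (𝕜 := 𝕜) (X := X) r), AlgHom.commutes]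
  { toFun := fun a => RingQuot.mkAlgHom 𝕜 (LocRel 𝕜 X) (FreeAlgebra.ι 𝕜 (.inl a))
    map_one' := by simpa using halg 1
    map_zero' := by simpa using halg 0
    map_mul' := hmul
    map_add' := hadd
    commutes' := halg }

theorem univLocMap_isLocalizationAtSet (X : Set R) :
    IsLocalizationAtSet 𝕜 (univLocMap 𝕜 X) X := by
  have hmul (x : X) : univLocMap 𝕜 X x.1 *
      RingQuot.mkAlgHom 𝕜 (LocRel 𝕜 X) (FreeAlgebra.ι 𝕜 (.inr x)) = 1 := by
    simpa [univLocMap] using RingQuot.mkAlgHom_rel 𝕜 (LocRel.mul_inv (𝕜 := 𝕜) x)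
  have hmul' (x : X) : RingQuot.mkAlgHom 𝕜 (LocRel 𝕜 X) (FreeAlgebra.ι 𝕜 (.inr x)) *
      univLocMap 𝕜 X x.1 = 1 := by
    simpa [univLocMap] using RingQuot.mkAlgHom_rel 𝕜 (LocRel.inv_mul (𝕜 := 𝕜) x)
  refine ⟨fun x hx => ⟨⟨_, _, hmul ⟨x, hx⟩, hmul' ⟨x, hx⟩⟩, rfl⟩, fun C _ _ g hg => ?_⟩
  choose u hu using hg
  let F : FreeAlgebra 𝕜 (R ⊕ X) →ₐ[𝕜] C :=
    FreeAlgebra.lift 𝕜 (Sum.elim g fun x => ↑(u x.1 x.2)⁻¹)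
  have hF : ∀ ⦃a b⦄, LocRel 𝕜 X a b → F a = F b := by
    rintro _ _ (⟨a, b⟩ | ⟨a, b⟩ | ⟨r⟩ | ⟨x⟩ | ⟨x⟩)
    · simp [F]
    · simp [F]
    · simp [F]
    · simp [F, ← hu x.1 x.2]
    · simp [F, ← hu x.1 x.2]
  refine ⟨RingQuot.liftAlgHom 𝕜 ⟨F, hF⟩, ?_, fun h hh => ?_⟩
  · ext a
    simp [univLocMap, F]
  · refine RingQuot.ringQuot_ext' _ _ _ (FreeAlgebra.hom_ext (funext fun s => ?_))
    have hl (a : R) : h (univLocMap 𝕜 X a) = g a := AlgHom.congr_fun hh a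
    rcases s with a | x
    · simpa [F, univLocMap] using hl a
    · have h1 := congrArg h (hmul x)
      rw [map_mul, hl, map_one, ← hu x.1 x.2] at h1
      simpa [F] using Units.eq_inv_of_mul_eq_one_left h1

variable {𝕜} {X Y : Set R}

theorem IsLocalizationAtSet.exists_algEquiv {f : R →ₐ[𝕜] S} {g : R →ₐ[𝕜] T}
    (hf : IsLocalizationAtSet 𝕜 f X) (hg : IsLocalizationAtSet 𝕜 g X) :
    ∃ e : S ≃ₐ[𝕜] T, ∀ a, e (f a) = g a := by
  obtain ⟨a, ha, -⟩ := hf.2 T g hg.1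
  obtain ⟨b, hb, -⟩ := hg.2 S f hf.1
  refine ⟨AlgEquiv.ofAlgHom a b ?_ ?_, fun x => AlgHom.congr_fun ha x⟩
  · refine (hg.2 T g hg.1).unique ?_ (AlgHom.id_comp g)
    rw [AlgHom.comp_assoc, hb, ha]
  · refine (hf.2 S f hf.1).unique ?_ (AlgHom.id_comp f)
    rw [AlgHom.comp_assoc, ha, hb]

theorem isLocalizationAtSet_id_empty :
    IsLocalizationAtSet 𝕜 (AlgHom.id 𝕜 R) ∅ :=
  ⟨fun _ h => h.elim, fun _ _ _ g _ => ⟨g, AlgHom.comp_id g, fun _ h => h⟩⟩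

theorem IsLocalizationAtSet.exists_isLocalizationAt {f : R →ₐ[𝕜] S} {g : R →ₐ[𝕜] T} {x : R}
    (hf : IsLocalizationAtSet 𝕜 f X) (hg : IsLocalizationAtSet 𝕜 g (insert x X)) :
    ∃ h : S →ₐ[𝕜] T, (∀ a, h (f a) = g a) ∧ IsLocalizationAt 𝕜 h (f x) := by
  obtain ⟨h, hh, -⟩ := hf.2 T g fun y hy => hg.1 y (Set.mem_insert_of_mem x hy)
  have hh' (a : R) : h (f a) = g a := AlgHom.congr_fun hh a
  refine ⟨h, hh', hh' x ▸ hg.1 x (Set.mem_insert x X), fun C _ _ k hk => ?_⟩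
  have hkf : ∀ y ∈ X, IsUnit (k.comp f y) := fun y hy => (hf.1 y hy).map k
  obtain ⟨l, hl, hl'⟩ := hg.2 C (k.comp f) (by
    rintro y (rfl | hy)
    exacts [hk, hkf y hy])
  refine ⟨l, (hf.2 C (k.comp f) hkf).unique ?_ rfl, fun l' h' => hl' l' ?_⟩
  · rw [AlgHom.comp_assoc, hh, hl]
  · change l'.comp g = k.comp f
    rw [← hh, ← AlgHom.comp_assoc, h']

theorem localizationChain_of_isLocalizationAtSet {n m : ℕ} (Q : ColoredQuiver n)
    (x : Fin m → DblPath 𝕜 Q) (f : DblPath 𝕜 Q →ₐ[𝕜] Boalch 𝕜 Q)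
    (hf : IsLocalizationAtSet 𝕜 f (Set.range x)) (hE : ∀ i, f (dE 𝕜 Q i) = bE 𝕜 Q i) :
    LocalizationChain 𝕜 Q m := by
  let X : Fin (m + 1) → Set (DblPath 𝕜 Q) := fun l => {a | ∃ j : Fin m, l ≤ j.castSucc ∧ x j = a}
  have hlast : X (Fin.last m) = ∅ := by
    refine Set.eq_empty_of_forall_notMem ?_
    rintro _ ⟨j, hj, -⟩
    exact absurd hj (not_le.2 (Fin.castSucc_lt_last j))
  have hzero : X 0 = Set.range x := by
    ext a
    simp [X]
  have hstep (l : Fin m) : X l.castSucc = insert (x l) (X l.succ) := by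
    ext a
    simp only [X, Set.mem_ofPred_eq, Set.mem_insert_iff, Fin.castSucc_le_castSucc_iff,
      Fin.succ_le_castSucc_iff]
    constructor
    · rintro ⟨j, hj, rfl⟩
      rcases hj.eq_or_lt with rfl | hj
      exacts [Or.inl rfl, Or.inr ⟨j, hj, rfl⟩]
    · rintro (rfl | ⟨j, hj, rfl⟩)
      exacts [⟨l, le_rfl, rfl⟩, ⟨j, hj.le, rfl⟩]
  have hloc (l) := univLocMap_isLocalizationAtSet 𝕜 (X l)
  obtain ⟨top, htop⟩ := (hloc (Fin.last m)).exists_algEquiv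
    (hlast ▸ isLocalizationAtSet_id_empty)
  obtain ⟨bot, hbot⟩ := (hloc 0).exists_algEquiv (hzero ▸ hf)
  have hstep' (l : Fin m) : IsLocalizationAtSet 𝕜 (univLocMap 𝕜 (X l.castSucc))
      (insert (x l) (X l.succ)) := by
    rw [← hstep]
    exact hloc l.castSucc
  choose h hh hx using fun l : Fin m =>
    (hloc l.succ).exists_isLocalizationAt (hstep' l)
  exact ⟨fun l => ⟨UnivLoc 𝕜 (X l), fun i => univLocMap 𝕜 (X l) (dE 𝕜 Q i)⟩, top, bot, h,
    fun i => htop _, fun i => (hbot _).trans (hE i), fun l i => hh l _, fun l => ⟨_, hx l⟩⟩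

end Localization

section Fission

omit [CharZero 𝕜]

variable {n : ℕ} (Q : ColoredQuiver n)

/-- The family of idempotents obtained from `e` by discarding the vertices outside `I_c`. -/
def colorIdem {A : Type*} [Ring A] (e : Fin n → A) (c : Q.C) (i : Fin n) : A :=
  if i ∈ Q.mem c then e i else 0

/-- The product `v_{-} v_{+}` of the unipotent elements with entries `v`. -/
def fissionElt {A : Type*} [Ring A] (ε : Fin n → A) (v : Fin n → Fin n → A) : A :=
  (tailSum ε 0 + ∑ p ∈ Finset.univ.filter (fun p : Fin n × Fin n => p.2 < p.1), v p.1 p.2) *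
    (tailSum ε 0 + ∑ p ∈ Finset.univ.filter (fun p : Fin n × Fin n => p.1 < p.2), v p.1 p.2)

variable {Q} in
theorem colorIdem_of_mem {A : Type*} [Ring A] (e : Fin n → A) {c : Q.C} {i : Fin n}
    (h : i ∈ Q.mem c) : colorIdem Q e c i = e i := if_pos h

variable {Q} in
theorem colorIdem_of_notMem {A : Type*} [Ring A] (e : Fin n → A) {c : Q.C} {i : Fin n}
    (h : i ∉ Q.mem c) : colorIdem Q e c i = 0 := if_neg h

theorem orthogonalIdempotents_colorIdem {A : Type*} [Ring A] {e : Fin n → A}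
    (he : OrthogonalIdempotents e) (c : Q.C) : OrthogonalIdempotents (colorIdem Q e c) := by
  refine OrthogonalIdempotents.iff_mul_eq.2 fun i j => ?_
  simp only [colorIdem, ite_mul, mul_ite, he.mul_eq, mul_zero, zero_mul]
  split_ifs <;> simp_all

theorem tailSum_colorIdem_zero {A : Type*} [Ring A] (e : Fin n → A) (c : Q.C) :
    tailSum (colorIdem Q e c) 0 = ∑ i ∈ Q.mem c, e i := by
  simp [tailSum_zero, colorIdem]

theorem map_colorIdem {A B F : Type*} [Ring A] [Ring B] [FunLike F A B] [RingHomClass F A B]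
    (g : F) (e : Fin n → A) (c : Q.C) (i : Fin n) :
    g (colorIdem Q e c i) = colorIdem Q (fun i => g (e i)) c i := by
  rw [colorIdem, colorIdem, apply_ite g, map_zero]

theorem map_fissionElt {A B F : Type*} [Ring A] [Ring B] [FunLike F A B] [RingHomClass F A B]
    (g : F) (ε : Fin n → A) (v : Fin n → Fin n → A) :
    g (fissionElt ε v) = fissionElt (fun i => g (ε i)) (fun i j => g (v i j)) := by
  simp [fissionElt, map_tailSum]

theorem tailSum_mul_fissionElt_mul {A : Type*} [Ring A] {ε : Fin n → A}
    (hε : OrthogonalIdempotents ε) {v : Fin n → Fin n → A}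
    (hv : ∀ i j, v i j = ε i * v i j * ε j) :
    tailSum ε 0 * fissionElt ε v * tailSum ε 0 = fissionElt ε v := by
  rw [fissionElt, ← mul_assoc, mul_add (tailSum ε 0), mul_assoc _ _ (tailSum ε 0),
    add_mul _ _ (tailSum ε 0), (IsStrictLower.sum hε hv).tailSum_zero_mul hε,
    (IsStrictUpper.sum hε hv).mul_tailSum_zero hε, tailSum_mul_self hε]

theorem orthogonalIdempotents_dE : OrthogonalIdempotents (dE 𝕜 Q) := by
  refine OrthogonalIdempotents.iff_mul_eq.2 fun i j => ?_
  have := RingQuot.mkAlgHom_rel 𝕜 (DblRel.orth (𝕜 := 𝕜) (Q := Q) i j)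
  rw [map_mul] at this
  exact this.trans (by split_ifs <;> simp [dE])

theorem sum_dE : ∑ i, dE 𝕜 Q i = 1 := by
  simpa [dE] using RingQuot.mkAlgHom_rel 𝕜 (DblRel.sum_one (𝕜 := 𝕜) (Q := Q))

theorem dV_of_dArr {c : Q.C} {i j : Fin n} (h : Q.DArr c i j) :
    dV 𝕜 Q c i j = dE 𝕜 Q i * dV 𝕜 Q c i j * dE 𝕜 Q j := by
  simpa [dE, dV] using RingQuot.mkAlgHom_rel 𝕜 (DblRel.vsupp (𝕜 := 𝕜) (Q := Q) c i j h)

theorem dV_of_not_dArr {c : Q.C} {i j : Fin n} (h : ¬ Q.DArr c i j) : dV 𝕜 Q c i j = 0 := by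
  simpa [dV] using RingQuot.mkAlgHom_rel 𝕜 (DblRel.vzero (𝕜 := 𝕜) (Q := Q) c i j h)

theorem dV_eq (c : Q.C) (i j : Fin n) : dV 𝕜 Q c i j =
    colorIdem Q (dE 𝕜 Q) c i * dV 𝕜 Q c i j * colorIdem Q (dE 𝕜 Q) c j := by
  by_cases h : Q.DArr c i j
  · rw [colorIdem_of_mem _ h.2.1, colorIdem_of_mem _ h.2.2.1, ← dV_of_dArr 𝕜 Q h]
  · rw [dV_of_not_dArr 𝕜 Q h, mul_zero, zero_mul]

theorem orthogonalIdempotents_bE : OrthogonalIdempotents (bE 𝕜 Q) := by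
  refine OrthogonalIdempotents.iff_mul_eq.2 fun i j => ?_
  have := RingQuot.mkAlgHom_rel 𝕜 (BoalchRel.orth (𝕜 := 𝕜) (Q := Q) i j)
  rw [map_mul] at this
  exact this.trans (by split_ifs <;> simp [bE])

theorem bW_of_notMem {c : Q.C} {i j : Fin n} (h : ¬ (i ≠ j ∧ i ∈ Q.mem c ∧ j ∈ Q.mem c)) :
    bW 𝕜 Q c i j = 0 := by
  simpa [bW] using RingQuot.mkAlgHom_rel 𝕜 (BoalchRel.wzero (𝕜 := 𝕜) (Q := Q) c i j h)

theorem bW_eq (c : Q.C) (i j : Fin n) : bW 𝕜 Q c i j =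
    colorIdem Q (bE 𝕜 Q) c i * bW 𝕜 Q c i j * colorIdem Q (bE 𝕜 Q) c j := by
  by_cases h : i ≠ j ∧ i ∈ Q.mem c ∧ j ∈ Q.mem c
  · rw [colorIdem_of_mem _ h.2.1, colorIdem_of_mem _ h.2.2]
    simpa [bE, bW] using RingQuot.mkAlgHom_rel 𝕜 (BoalchRel.wsupp (𝕜 := 𝕜) (Q := Q) c i j h)
  · rw [bW_of_notMem 𝕜 Q h, mul_zero, zero_mul]

theorem bG_of_notMem {c : Q.C} {i : Fin n} (h : i ∉ Q.mem c) : bG 𝕜 Q c i = 0 := by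
  simpa [bG] using RingQuot.mkAlgHom_rel 𝕜 (BoalchRel.gzero (𝕜 := 𝕜) (Q := Q) c i h)

theorem bGi_of_notMem {c : Q.C} {i : Fin n} (h : i ∉ Q.mem c) : bGi 𝕜 Q c i = 0 := by
  simpa [bGi] using RingQuot.mkAlgHom_rel 𝕜 (BoalchRel.gizero (𝕜 := 𝕜) (Q := Q) c i h)

theorem bG_eq (c : Q.C) (i : Fin n) : bG 𝕜 Q c i =
    colorIdem Q (bE 𝕜 Q) c i * bG 𝕜 Q c i * colorIdem Q (bE 𝕜 Q) c i := by
  by_cases h : i ∈ Q.mem c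
  · rw [colorIdem_of_mem _ h]
    simpa [bE, bG] using RingQuot.mkAlgHom_rel 𝕜 (BoalchRel.gsupp (𝕜 := 𝕜) (Q := Q) c i h)
  · rw [bG_of_notMem 𝕜 Q h, mul_zero, zero_mul]

theorem bGi_eq (c : Q.C) (i : Fin n) : bGi 𝕜 Q c i =
    colorIdem Q (bE 𝕜 Q) c i * bGi 𝕜 Q c i * colorIdem Q (bE 𝕜 Q) c i := by
  by_cases h : i ∈ Q.mem c
  · rw [colorIdem_of_mem _ h]
    simpa [bE, bGi] using RingQuot.mkAlgHom_rel 𝕜 (BoalchRel.gisupp (𝕜 := 𝕜) (Q := Q) c i h)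
  · rw [bGi_of_notMem 𝕜 Q h, mul_zero, zero_mul]

theorem bG_mul_bGi (c : Q.C) (i : Fin n) :
    bG 𝕜 Q c i * bGi 𝕜 Q c i = colorIdem Q (bE 𝕜 Q) c i := by
  by_cases h : i ∈ Q.mem c
  · rw [colorIdem_of_mem _ h]
    simpa [bE, bG, bGi] using RingQuot.mkAlgHom_rel 𝕜 (BoalchRel.ginv (𝕜 := 𝕜) (Q := Q) c i h)
  · rw [bG_of_notMem 𝕜 Q h, colorIdem_of_notMem _ h, zero_mul]

theorem bGi_mul_bG (c : Q.C) (i : Fin n) :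
    bGi 𝕜 Q c i * bG 𝕜 Q c i = colorIdem Q (bE 𝕜 Q) c i := by
  by_cases h : i ∈ Q.mem c
  · rw [colorIdem_of_mem _ h]
    simpa [bE, bG, bGi] using RingQuot.mkAlgHom_rel 𝕜 (BoalchRel.ginv' (𝕜 := 𝕜) (Q := Q) c i h)
  · rw [bG_of_notMem 𝕜 Q h, colorIdem_of_notMem _ h, mul_zero]

theorem boalch_isUDL (c : Q.C) :
    IsUDL (colorIdem Q (bE 𝕜 Q) c) (fissionElt (colorIdem Q (bE 𝕜 Q) c) (bV 𝕜 Q c))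
      (∑ p ∈ Finset.univ.filter (fun p : Fin n × Fin n => p.1 < p.2), bW 𝕜 Q c p.1 p.2)
      (∑ i, bG 𝕜 Q c i) (∑ i, bGi 𝕜 Q c i)
      (∑ p ∈ Finset.univ.filter (fun p : Fin n × Fin n => p.2 < p.1), bW 𝕜 Q c p.1 p.2) := by
  refine .of_entries (orthogonalIdempotents_colorIdem Q (orthogonalIdempotents_bE 𝕜 Q) c)
    (bW_eq 𝕜 Q c) (bG_eq 𝕜 Q c) (bGi_eq 𝕜 Q c) (bG_mul_bGi 𝕜 Q c) (bGi_mul_bG 𝕜 Q c) ?_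
  have hG : ∑ i, bG 𝕜 Q c i = ∑ i ∈ Q.mem c, bG 𝕜 Q c i :=
    (Finset.sum_subset (Finset.subset_univ _) fun i _ h => bG_of_notMem 𝕜 Q h).symm
  have := RingQuot.mkAlgHom_rel 𝕜 (BoalchRel.main (𝕜 := 𝕜) (Q := Q) c)
  rw [fissionElt, tailSum_colorIdem_zero, hG]
  simpa [vcMinus, vcPlus, wcMinus, wcPlus, gamC, oneIc, bE, bV, bW, bG] using this

/-- The canonical map from the path algebra of the double to the Boalch algebra. -/
noncomputable def dblToBoalch : DblPath 𝕜 Q →ₐ[𝕜] Boalch 𝕜 Q :=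
  RingQuot.liftAlgHom 𝕜 ⟨FreeAlgebra.lift 𝕜 fun
    | .E i => bE 𝕜 Q i
    | .V c i j => bV 𝕜 Q c i j, by
    rintro _ _ (⟨i, j⟩ | _ | ⟨c, i, j, h⟩ | ⟨c, i, j, h⟩)
    · have := (orthogonalIdempotents_bE 𝕜 Q).mul_eq i j
      split_ifs at this ⊢ <;> simpa using this
    · simpa [bE] using RingQuot.mkAlgHom_rel 𝕜 (BoalchRel.sum_one (𝕜 := 𝕜) (Q := Q))
    · simpa [bE, bV] using RingQuot.mkAlgHom_rel 𝕜 (BoalchRel.vsupp (𝕜 := 𝕜) (Q := Q) c i j h)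
    · simpa [bV] using RingQuot.mkAlgHom_rel 𝕜 (BoalchRel.vzero (𝕜 := 𝕜) (Q := Q) c i j h)⟩

@[simp]
theorem dblToBoalch_dE (i : Fin n) : dblToBoalch 𝕜 Q (dE 𝕜 Q i) = bE 𝕜 Q i := by
  simp [dblToBoalch, dE]

@[simp]
theorem dblToBoalch_dV (c : Q.C) (i j : Fin n) :
    dblToBoalch 𝕜 Q (dV 𝕜 Q c i j) = bV 𝕜 Q c i j := by
  simp [dblToBoalch, dV]

/-- The element of the path algebra of the double whose inversion makes the lower right corner
`(v_{c-} v_{c+})_{≥ k}` invertible. -/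
noncomputable def dblCorner (c : Q.C) (k : ℕ) : DblPath 𝕜 Q :=
  cornerElt (colorIdem Q (dE 𝕜 Q) c) (fissionElt (colorIdem Q (dE 𝕜 Q) c) (dV 𝕜 Q c)) k

theorem map_dblCorner {A : Type*} [Ring A] [Algebra 𝕜 A] (g : DblPath 𝕜 Q →ₐ[𝕜] A) (c : Q.C)
    (k : ℕ) : g (dblCorner 𝕜 Q c k) = cornerElt (colorIdem Q (fun i => g (dE 𝕜 Q i)) c)
      (fissionElt (colorIdem Q (fun i => g (dE 𝕜 Q i)) c) (fun i j => g (dV 𝕜 Q c i j))) k := by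
  simp only [dblCorner, map_cornerElt, map_fissionElt, map_colorIdem]

variable {𝕜 Q} in
theorem boalch_hom_ext {A : Type*} [Ring A] [Algebra 𝕜 A] {g h : Boalch 𝕜 Q →ₐ[𝕜] A}
    (hgh : g.comp (dblToBoalch 𝕜 Q) = h.comp (dblToBoalch 𝕜 Q)) : g = h := by
  have hE (i) : g (bE 𝕜 Q i) = h (bE 𝕜 Q i) := by
    simpa using AlgHom.congr_fun hgh (dE 𝕜 Q i)
  have hV (c i j) : g (bV 𝕜 Q c i j) = h (bV 𝕜 Q c i j) := by
    simpa using AlgHom.congr_fun hgh (dV 𝕜 Q c i j)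
  have hεc (c i) : g (colorIdem Q (bE 𝕜 Q) c i) = h (colorIdem Q (bE 𝕜 Q) c i) := by
    simp only [map_colorIdem, hE]
  have hM (c) : g (fissionElt (colorIdem Q (bE 𝕜 Q) c) (bV 𝕜 Q c)) =
      h (fissionElt (colorIdem Q (bE 𝕜 Q) c) (bV 𝕜 Q c)) := by
    simp only [map_fissionElt, hεc, hV]
  have horth (c) := orthogonalIdempotents_colorIdem Q (orthogonalIdempotents_bE 𝕜 Q) c
  have huniq (c : Q.C) := by
    have hg := (boalch_isUDL 𝕜 Q c).map g.toRingHom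
    have hh := (boalch_isUDL 𝕜 Q c).map h.toRingHom
    simp only [AlgHom.toRingHom_eq_coe, RingHom.coe_coe, hεc, hM] at hg hh
    exact hg.unique ((horth c).map h.toRingHom) hh
  refine RingQuot.ringQuot_ext' _ _ _ (FreeAlgebra.hom_ext (funext fun s => ?_))
  rcases s with i | ⟨c, i, j⟩ | ⟨c, i, j⟩ | ⟨c, i⟩ | ⟨c, i⟩
  · exact hE i
  · exact hV c i j
  · change g (bW 𝕜 Q c i j) = h (bW 𝕜 Q c i j)
    rcases lt_trichotomy i j with hij | rfl | hij
    · rw [← idem_mul_sum_filter_mul_idem (horth c) (bW_eq 𝕜 Q c) (fun p => p.1 < p.2) hij]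
      simp only [map_mul, hεc, (huniq c).1]
    · rw [bW_of_notMem 𝕜 Q fun h => h.1 rfl, map_zero, map_zero]
    · rw [← idem_mul_sum_filter_mul_idem (horth c) (bW_eq 𝕜 Q c) (fun p => p.2 < p.1) hij]
      simp only [map_mul, hεc, (huniq c).2.2.2]
  · change g (bG 𝕜 Q c i) = h (bG 𝕜 Q c i)
    rw [← idem_mul_sum_mul_idem (horth c) (bG_eq 𝕜 Q c)]
    simp only [map_mul, hεc, (huniq c).2.1]
  · change g (bGi 𝕜 Q c i) = h (bGi 𝕜 Q c i)
    rw [← idem_mul_sum_mul_idem (horth c) (bGi_eq 𝕜 Q c)]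
    simp only [map_mul, hεc, (huniq c).2.2.1]

theorem exists_boalch_lift {A : Type*} [Ring A] [Algebra 𝕜 A] (g : DblPath 𝕜 Q →ₐ[𝕜] A)
    (hg : ∀ (c : Q.C) (k : Fin n), IsUnit (g (dblCorner 𝕜 Q c k))) :
    ∃ h : Boalch 𝕜 Q →ₐ[𝕜] A, h.comp (dblToBoalch 𝕜 Q) = g := by
  have he : OrthogonalIdempotents fun i => g (dE 𝕜 Q i) :=
    (orthogonalIdempotents_dE 𝕜 Q).map g.toRingHom
  have hε (c) := orthogonalIdempotents_colorIdem Q he c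
  have hv (c i j) : g (dV 𝕜 Q c i j) = colorIdem Q (fun i => g (dE 𝕜 Q i)) c i *
      g (dV 𝕜 Q c i j) * colorIdem Q (fun i => g (dE 𝕜 Q i)) c j := by
    simpa only [map_mul, map_colorIdem] using congrArg g (dV_eq 𝕜 Q c i j)
  simp only [map_dblCorner] at hg
  choose w γ γ' hw hwd hγ hγ' hmul hmul' hM using fun c =>
    exists_triangular_factors (hε c) (tailSum_mul_fissionElt_mul (hε c) (hv c)) (hg c)
  have hγ0 {c i} (h : i ∉ Q.mem c) : γ c i = 0 := by
    rw [hγ, colorIdem_of_notMem _ h, mul_zero]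
  let F : FreeAlgebra 𝕜 (BGen n Q.C) →ₐ[𝕜] A := FreeAlgebra.lift 𝕜 fun
    | .E i => g (dE 𝕜 Q i)
    | .V c i j => g (dV 𝕜 Q c i j)
    | .W c i j => w c i j
    | .G c i => γ c i
    | .Gi c i => γ' c i
  have hF : ∀ ⦃x y⦄, BoalchRel 𝕜 Q x y → F x = F y := by
    intro x y hxy
    cases hxy with
    | orth i j =>
      have := he.mul_eq i j
      split_ifs at this ⊢ <;> simpa [F] using this
    | sum_one => simpa [F] using congrArg g (sum_dE 𝕜 Q)
    | vsupp c i j h => simpa [F] using congrArg g (dV_of_dArr 𝕜 Q h)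
    | vzero c i j h => simpa [F] using congrArg g (dV_of_not_dArr 𝕜 Q h)
    | wsupp c i j h => simpa [F, colorIdem, h] using hw c i j
    | wzero c i j h =>
      have : w c i j = 0 := by
        by_cases hij : i = j
        · rw [hij, hwd]
        · by_cases hi : i ∈ Q.mem c
          · rw [hw, colorIdem_of_notMem _ fun hj => h ⟨hij, hi, hj⟩, mul_zero]
          · rw [hw, colorIdem_of_notMem _ hi, zero_mul, zero_mul]
      simpa [F] using this
    | gsupp c i h => simpa [F, colorIdem, h] using hγ c i
    | gzero c i h => simpa [F] using hγ0 h
    | gisupp c i h => simpa [F, colorIdem, h] using hγ' c i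
    | gizero c i h =>
      have : γ' c i = 0 := by rw [hγ', colorIdem_of_notMem _ h, mul_zero]
      simpa [F] using this
    | ginv c i h => simpa [F, colorIdem, h] using hmul c i
    | ginv' c i h => simpa [F, colorIdem, h] using hmul' c i
    | main c =>
      have hG : ∑ i, γ c i = ∑ i ∈ Q.mem c, γ c i :=
        (Finset.sum_subset (Finset.subset_univ _) fun i _ h => hγ0 h).symm
      have := hM c
      rw [fissionElt, tailSum_colorIdem_zero, hG] at this
      simpa [F, vcMinus, vcPlus, wcMinus, wcPlus, gamC, oneIc] using this
  refine ⟨RingQuot.liftAlgHom 𝕜 ⟨F, hF⟩,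
    RingQuot.ringQuot_ext' _ _ _ (FreeAlgebra.hom_ext (funext fun s => ?_))⟩
  rcases s with i | ⟨c, i, j⟩
  · change RingQuot.liftAlgHom 𝕜 ⟨F, hF⟩ (dblToBoalch 𝕜 Q (dE 𝕜 Q i)) = g (dE 𝕜 Q i)
    simp [bE, F]
  · change RingQuot.liftAlgHom 𝕜 ⟨F, hF⟩ (dblToBoalch 𝕜 Q (dV 𝕜 Q c i j)) = g (dV 𝕜 Q c i j)
    simp [bV, F]

theorem dblToBoalch_isLocalizationAtSet : IsLocalizationAtSet 𝕜 (dblToBoalch 𝕜 Q)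
    (Set.range fun p : Q.C × Fin n => dblCorner 𝕜 Q p.1 p.2) := by
  refine ⟨?_, fun C _ _ g hg => ?_⟩
  · rintro _ ⟨⟨c, k⟩, rfl⟩
    simp only [map_dblCorner, dblToBoalch_dE, dblToBoalch_dV]
    exact (boalch_isUDL 𝕜 Q c).isUnit_cornerElt
      (orthogonalIdempotents_colorIdem Q (orthogonalIdempotents_bE 𝕜 Q) c) k
  · obtain ⟨h, hh⟩ := exists_boalch_lift 𝕜 Q g fun c k => hg _ ⟨(c, k), rfl⟩
    exact ⟨h, hh, fun h' hh' => boalch_hom_ext (hh'.trans hh.symm)⟩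

theorem localizationChain_of_surjective {m : ℕ} (e : Fin m → Q.C × Fin n)
    (he : Function.Surjective e) : LocalizationChain 𝕜 Q m := by
  refine localizationChain_of_isLocalizationAtSet Q
    (fun l => dblCorner 𝕜 Q (e l).1 (e l).2) (dblToBoalch 𝕜 Q) ?_ (dblToBoalch_dE 𝕜 Q)
  have := he.range_comp fun p : Q.C × Fin n => dblCorner 𝕜 Q p.1 p.2
  rw [Function.comp_def] at this
  rw [this]
  exact dblToBoalch_isLocalizationAtSet 𝕜 Q

end Fission

/-- Lemma 3.6. If `Υ` is monochromatic with `n` vertices, then there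
is a chain of homomorphisms of algebras over `B`,
`𝕜Ῡ = A_n → A_{n-1} → ⋯ → A_1 → A_0 = B(Υ)`, in which each step is a localization at a
single element. In particular, for an arbitrary colored quiver `Υ`, the Boalch algebra
`B(Υ)` is a localization of the path algebra `𝕜Ῡ` of the double quiver. -/
theorem statement_0 (𝕜 : Type) [Field 𝕜] [CharZero 𝕜] {n : ℕ} (Q : ColoredQuiver n) :
    ((∃ c₀ : Q.C, (∀ c : Q.C, c = c₀) ∧ Q.mem c₀ = Finset.univ) →
        LocalizationChain 𝕜 Q n)
    ∧ (∃ m : ℕ, LocalizationChain 𝕜 Q m) := by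
  constructor
  · rintro ⟨c₀, hc₀, -⟩
    exact localizationChain_of_surjective 𝕜 Q (fun k => (c₀, k))
      fun ⟨c, k⟩ => ⟨k, by rw [hc₀ c]⟩
  · exact ⟨_, localizationChain_of_surjective 𝕜 Q (Fintype.equivFin (Q.C × Fin n)).symm
      (Equiv.surjective _)⟩

end NCQP
end

section
/- Let Υ be a colored quiver in which each monochromatic subquiver Υ_c = 𝔠^{-1}(c) consists of exactly one arrow. Then there are isomorphisms of B-algebras B(Υ) ≅ A(Υ) and, for every parameter q ∈ (k^×)^I, F^q(Υ) ≅ Λ^q(Υ), where A(Υ) is Van den Bergh's localized path algebra of the double quiver and Λ^q(Υ) is the multiplicative preprojective algebra of Crawley-Boevey and Shaw. -/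
open TensorProduct

namespace NCQP

variable (𝕜 : Type) [Field 𝕜] [CharZero 𝕜]

/-! ### Van den Bergh's algebra `A(Υ)`, multiplicative preprojective algebras and
fission algebras -/

/-- Generators of Van den Bergh's localized path algebra `A(Υ)`: the idempotents `E i`,
the arrows `A c i j : j → i` of the double quiver, and the local inverses
`T c i j = (e_i + a a^*)^{-1}` for the arrow `a = A c i j` with head `i`. -/
inductive VGen (n : ℕ) (C : Type) : Type
  | E : Fin n → VGen n C
  | A : C → Fin n → Fin n → VGen n C
  | T : C → Fin n → Fin n → VGen n C

section VdB

variable {n : ℕ} (Q : ColoredQuiver n)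

noncomputable abbrev vfE (i : Fin n) : FreeAlgebra 𝕜 (VGen n Q.C) :=
  FreeAlgebra.ι 𝕜 (VGen.E i)
noncomputable abbrev vfA (c : Q.C) (i j : Fin n) : FreeAlgebra 𝕜 (VGen n Q.C) :=
  FreeAlgebra.ι 𝕜 (VGen.A c i j)
noncomputable abbrev vfT (c : Q.C) (i j : Fin n) : FreeAlgebra 𝕜 (VGen n Q.C) :=
  FreeAlgebra.ι 𝕜 (VGen.T c i j)

/-- The defining relations of Van den Bergh's algebra `A(Υ)`: the path algebra
relations of the double quiver `Ῡ` together with the universal localization at the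
elements `1 + a a^*`, `a ∈ Ῡ` (local inverses at the head idempotent of each arrow). -/
inductive VRel : FreeAlgebra 𝕜 (VGen n Q.C) → FreeAlgebra 𝕜 (VGen n Q.C) → Prop
  | orth (i j : Fin n) :
      VRel (vfE 𝕜 Q i * vfE 𝕜 Q j) (if i = j then vfE 𝕜 Q i else 0)
  | sum_one : VRel (∑ i : Fin n, vfE 𝕜 Q i) 1
  | asupp (c : Q.C) (i j : Fin n) (h : Q.DArr c i j) :
      VRel (vfA 𝕜 Q c i j) (vfE 𝕜 Q i * vfA 𝕜 Q c i j * vfE 𝕜 Q j)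
  | azero (c : Q.C) (i j : Fin n) (h : ¬ Q.DArr c i j) :
      VRel (vfA 𝕜 Q c i j) 0
  | tsupp (c : Q.C) (i j : Fin n) (h : Q.DArr c i j) :
      VRel (vfT 𝕜 Q c i j) (vfE 𝕜 Q i * vfT 𝕜 Q c i j * vfE 𝕜 Q i)
  | tzero (c : Q.C) (i j : Fin n) (h : ¬ Q.DArr c i j) :
      VRel (vfT 𝕜 Q c i j) 0
  | tinv (c : Q.C) (i j : Fin n) (h : Q.DArr c i j) :
      VRel ((vfE 𝕜 Q i + vfA 𝕜 Q c i j * vfA 𝕜 Q c j i) * vfT 𝕜 Q c i j) (vfE 𝕜 Q i)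
  | tinv' (c : Q.C) (i j : Fin n) (h : Q.DArr c i j) :
      VRel (vfT 𝕜 Q c i j * (vfE 𝕜 Q i + vfA 𝕜 Q c i j * vfA 𝕜 Q c j i)) (vfE 𝕜 Q i)

/-- Van den Bergh's algebra `A(Υ)`: the path algebra of the double quiver universally
localized at the elements `1 + a a^*`. -/
abbrev VdBAlg : Type := RingQuot (VRel 𝕜 Q)

/-- The idempotents `e_i ∈ A(Υ)`. -/
noncomputable def vE (i : Fin n) : VdBAlg 𝕜 Q :=
  RingQuot.mkAlgHom 𝕜 (VRel 𝕜 Q) (vfE 𝕜 Q i)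

/-- The defining relations of the multiplicative preprojective algebra `Λ^q(Υ)`: the
relations of `A(Υ)` together with `∏_{a ∈ Ῡ} (1 + a a^*)^{ε(a)} = ∑_s q_s e_s`, the
product at each vertex `s` being taken over the double arrows with head `s`, in the
order recorded by the list `ordArr s`; a factor is `e_s + a a^*` if `a` is an original
arrow of `Υ` (i.e. `ε(a) = +1`, its tail being larger than its head) and the local
inverse `(e_s + a a^*)^{-1}` otherwise. -/
inductive MPARel (q : Fin n → 𝕜ˣ) (ordArr : Fin n → List (Q.C × Fin n)) :
    FreeAlgebra 𝕜 (VGen n Q.C) → FreeAlgebra 𝕜 (VGen n Q.C) → Prop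
  | base {x y : FreeAlgebra 𝕜 (VGen n Q.C)} : VRel 𝕜 Q x y → MPARel q ordArr x y
  | mom (s : Fin n) : MPARel q ordArr
      (((ordArr s).map (fun cj =>
          if s < cj.2 then
            vfE 𝕜 Q s + vfA 𝕜 Q cj.1 s cj.2 * vfA 𝕜 Q cj.1 cj.2 s
          else vfT 𝕜 Q cj.1 s cj.2)).prod)
      ((q s : 𝕜) • vfE 𝕜 Q s)

/-- The multiplicative preprojective algebra `Λ^q(Υ)` of Crawley-Boevey and Shaw. -/
abbrev MPA (q : Fin n → 𝕜ˣ) (ordArr : Fin n → List (Q.C × Fin n)) : Type :=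
  RingQuot (MPARel 𝕜 Q q ordArr)

/-- The idempotents `e_i ∈ Λ^q(Υ)`. -/
noncomputable def mpaE (q : Fin n → 𝕜ˣ) (ordArr : Fin n → List (Q.C × Fin n))
    (i : Fin n) : MPA 𝕜 Q q ordArr :=
  RingQuot.mkAlgHom 𝕜 (MPARel 𝕜 Q q ordArr) (vfE 𝕜 Q i)

/-- The defining relations of the fission algebra `F^q(Υ) = B(Υ)/R_q`: the relations of
the Boalch algebra together with `∏_{c ∋ s} γ_{c,s} = q_s e_s` for each vertex `s`, the
product being taken in the order of the colors at `s` recorded by `ordCol s`. -/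
inductive FissRel (q : Fin n → 𝕜ˣ) (ordCol : Fin n → List Q.C) :
    FreeAlgebra 𝕜 (BGen n Q.C) → FreeAlgebra 𝕜 (BGen n Q.C) → Prop
  | base {x y : FreeAlgebra 𝕜 (BGen n Q.C)} : BoalchRel 𝕜 Q x y → FissRel q ordCol x y
  | mom (s : Fin n) : FissRel q ordCol
      (((ordCol s).map (fun c => bfG 𝕜 Q c s)).prod)
      ((q s : 𝕜) • bfE 𝕜 Q s)

/-- The fission algebra `F^q(Υ)` with parameter `q`. -/
abbrev Fission (q : Fin n → 𝕜ˣ) (ordCol : Fin n → List Q.C) : Type :=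
  RingQuot (FissRel 𝕜 Q q ordCol)

/-- The idempotents `e_i ∈ F^q(Υ)`. -/
noncomputable def fissE (q : Fin n → 𝕜ˣ) (ordCol : Fin n → List Q.C) (i : Fin n) :
    Fission 𝕜 Q q ordCol :=
  RingQuot.mkAlgHom 𝕜 (FissRel 𝕜 Q q ordCol) (bfE 𝕜 Q i)

end VdB

end NCQP

namespace NCQP

section Presentations

variable {𝕜 : Type} [Field 𝕜] {X Y R : Type} [Ring R] [Algebra 𝕜 R]

/-- A family of elements of `R` satisfies the relations `r`. -/
def Respects (r : FreeAlgebra 𝕜 X → FreeAlgebra 𝕜 X → Prop) (f : X → R) : Prop :=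
  ∀ ⦃x y⦄, r x y → FreeAlgebra.lift 𝕜 f x = FreeAlgebra.lift 𝕜 f y

/-- The tautological family of generators of a presented algebra. -/
noncomputable def gen (r : FreeAlgebra 𝕜 X → FreeAlgebra 𝕜 X → Prop) (x : X) : RingQuot r :=
  RingQuot.mkAlgHom 𝕜 r (FreeAlgebra.ι 𝕜 x)

theorem lift_gen (r : FreeAlgebra 𝕜 X → FreeAlgebra 𝕜 X → Prop) :
    FreeAlgebra.lift 𝕜 (gen r) = RingQuot.mkAlgHom 𝕜 r := by
  ext x
  simp [gen]

theorem respects_gen (r : FreeAlgebra 𝕜 X → FreeAlgebra 𝕜 X → Prop) :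
    Respects r (gen r) := by
  intro x y h
  rw [lift_gen]
  exact RingQuot.mkAlgHom_rel 𝕜 h

/-- The algebra map out of a presented algebra given by a family satisfying the relations. -/
noncomputable def descend {r : FreeAlgebra 𝕜 X → FreeAlgebra 𝕜 X → Prop} {f : X → R}
    (hf : Respects r f) : RingQuot r →ₐ[𝕜] R :=
  RingQuot.liftAlgHom 𝕜 ⟨FreeAlgebra.lift 𝕜 f, fun _ _ h => hf h⟩

theorem descend_gen {r : FreeAlgebra 𝕜 X → FreeAlgebra 𝕜 X → Prop} {f : X → R}
    (hf : Respects r f) (x : X) : descend hf (gen r x) = f x := by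
  rw [descend, gen, RingQuot.liftAlgHom_mkAlgHom_apply, FreeAlgebra.lift_ι_apply]

theorem exists_algEquiv_of_respects {r : FreeAlgebra 𝕜 X → FreeAlgebra 𝕜 X → Prop}
    {r' : FreeAlgebra 𝕜 Y → FreeAlgebra 𝕜 Y → Prop}
    {g : X → RingQuot r'} {h : Y → RingQuot r} (hg : Respects r g) (hh : Respects r' h)
    (hgh : ∀ x, descend hh (g x) = gen r x) (hhg : ∀ y, descend hg (h y) = gen r' y) :
    ∃ φ : RingQuot r ≃ₐ[𝕜] RingQuot r', ∀ x, φ (gen r x) = g x := by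
  refine ⟨AlgEquiv.ofAlgHom (descend hg) (descend hh) ?_ ?_, fun x => descend_gen hg x⟩
  · apply RingQuot.ringQuot_ext'
    ext y
    change descend hg (descend hh (gen r' y)) = gen r' y
    rw [descend_gen, hhg]
  · apply RingQuot.ringQuot_ext'
    ext x
    change descend hh (descend hg (gen r x)) = gen r x
    rw [descend_gen, hgh]

end Presentations

section OneArrow

variable {𝕜 : Type} [Field 𝕜] {n : ℕ} {Q : ColoredQuiver n} {lo hi : Q.C → Fin n}

/-- Each monochromatic subquiver of color `c` is a single arrow `hi c → lo c`. -/
structure IsOneArrow (Q : ColoredQuiver n) (lo hi : Q.C → Fin n) : Prop where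
  lt (c : Q.C) : lo c < hi c
  mem (c : Q.C) : Q.mem c = {lo c, hi c}
  part (c : Q.C) : Q.part c (lo c) ≠ Q.part c (hi c)

theorem IsOneArrow.mem_iff (hQ : IsOneArrow Q lo hi) (c : Q.C) (i : Fin n) :
    i ∈ Q.mem c ↔ i = lo c ∨ i = hi c := by
  simp [hQ.mem c]

theorem IsOneArrow.ne_and_mem_iff (hQ : IsOneArrow Q lo hi) (c : Q.C) (i j : Fin n) :
    (i ≠ j ∧ i ∈ Q.mem c ∧ j ∈ Q.mem c) ↔
      (i = lo c ∧ j = hi c) ∨ (i = hi c ∧ j = lo c) := by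
  have := (hQ.lt c).ne
  rw [hQ.mem_iff, hQ.mem_iff]
  grind

theorem IsOneArrow.dArr_iff (hQ : IsOneArrow Q lo hi) (c : Q.C) (i j : Fin n) :
    Q.DArr c i j ↔ (i = lo c ∧ j = hi c) ∨ (i = hi c ∧ j = lo c) := by
  have := hQ.part c
  have := hQ.ne_and_mem_iff c i j
  unfold ColoredQuiver.DArr
  grind

theorem IsOneArrow.sum_lt (hQ : IsOneArrow Q lo hi) {M : Type*} [AddCommMonoid M] (c : Q.C)
    (h : Fin n → Fin n → M)
    (h0 : ∀ i j, ¬ ((i = lo c ∧ j = hi c) ∨ (i = hi c ∧ j = lo c)) → h i j = 0) :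
    ∑ p ∈ Finset.univ.filter (fun p : Fin n × Fin n => p.1 < p.2), h p.1 p.2 =
      h (lo c) (hi c) := by
  have hlt := hQ.lt c
  rw [Finset.sum_eq_single (lo c, hi c)]
  · rintro ⟨i, j⟩ hp hne
    apply h0
    simp only [Finset.mem_filter, Finset.mem_univ, true_and] at hp
    rintro (⟨rfl, rfl⟩ | ⟨rfl, rfl⟩)
    · exact hne rfl
    · exact lt_asymm hp hlt
  · simp [hlt]

theorem IsOneArrow.sum_gt (hQ : IsOneArrow Q lo hi) {M : Type*} [AddCommMonoid M] (c : Q.C)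
    (h : Fin n → Fin n → M)
    (h0 : ∀ i j, ¬ ((i = lo c ∧ j = hi c) ∨ (i = hi c ∧ j = lo c)) → h i j = 0) :
    ∑ p ∈ Finset.univ.filter (fun p : Fin n × Fin n => p.2 < p.1), h p.1 p.2 =
      h (hi c) (lo c) := by
  have hlt := hQ.lt c
  rw [Finset.sum_eq_single (hi c, lo c)]
  · rintro ⟨i, j⟩ hp hne
    apply h0
    simp only [Finset.mem_filter, Finset.mem_univ, true_and] at hp
    rintro (⟨rfl, rfl⟩ | ⟨rfl, rfl⟩)
    · exact lt_asymm hp hlt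
    · exact hne rfl
  · simp [hlt]

theorem IsOneArrow.sum_mem (hQ : IsOneArrow Q lo hi) {M : Type*} [AddCommMonoid M] (c : Q.C)
    (h : Fin n → M) : ∑ i ∈ Q.mem c, h i = h (lo c) + h (hi c) := by
  rw [hQ.mem c, Finset.sum_pair (hQ.lt c).ne]

variable {R S : Type} [Ring R] [Algebra 𝕜 R] [Ring S] [Algebra 𝕜 S]

variable (lo hi) in
/-- The generators of the Boalch algebra expressed through those of Van den Bergh's algebra. -/
def boalchOfVdB (f : VGen n Q.C → R) : BGen n Q.C → R
  | .E i => f (.E i)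
  | .V c i j =>
      if i = lo c ∧ j = hi c then -(f (.A c i j) * f (.T c j i))
      else if i = hi c ∧ j = lo c then f (.A c i j) else 0
  | .W c i j =>
      if i = lo c ∧ j = hi c then -f (.A c i j)
      else if i = hi c ∧ j = lo c then
        (f (.E i) + f (.A c i j) * f (.A c j i)) * f (.A c i j) else 0
  | .G c i =>
      if i = lo c then f (.E i) + f (.A c i (hi c)) * f (.A c (hi c) i)
      else if i = hi c then f (.T c i (lo c)) else 0
  | .Gi c i =>
      if i = lo c then f (.T c i (hi c))
      else if i = hi c then f (.E i) + f (.A c i (lo c)) * f (.A c (lo c) i) else 0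

variable (lo hi) in
/-- The generators of Van den Bergh's algebra expressed through those of the Boalch algebra. -/
def vdBOfBoalch (g : BGen n Q.C → R) : VGen n Q.C → R
  | .E i => g (.E i)
  | .A c i j =>
      if i = lo c ∧ j = hi c then -g (.W c i j)
      else if i = hi c ∧ j = lo c then g (.V c i j) else 0
  | .T c i j =>
      if i = lo c ∧ j = hi c then g (.Gi c i)
      else if i = hi c ∧ j = lo c then g (.G c i) else 0

theorem map_boalchOfVdB (φ : R →ₐ[𝕜] S) (f : VGen n Q.C → R) (x : BGen n Q.C) :
    φ (boalchOfVdB lo hi f x) = boalchOfVdB lo hi (fun y => φ (f y)) x := by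
  cases x <;> simp only [boalchOfVdB] <;> split_ifs <;> simp

theorem map_vdBOfBoalch (φ : R →ₐ[𝕜] S) (g : BGen n Q.C → R) (x : VGen n Q.C) :
    φ (vdBOfBoalch lo hi g x) = vdBOfBoalch lo hi (fun y => φ (g y)) x := by
  cases x <;> simp only [vdBOfBoalch] <;> split_ifs <;> simp

/-- The relations between the generators of Van den Bergh's algebra of one color. -/
structure VdBArrow (e f a b t t' : R) : Prop where
  ee : e * e = e
  ff : f * f = f
  ef : e * f = 0
  fe : f * e = 0
  a_supp : a = e * a * f
  b_supp : b = f * b * e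
  t_supp : t = e * t * e
  t'_supp : t' = f * t' * f
  mul_t : (e + a * b) * t = e
  t_mul : t * (e + a * b) = e
  mul_t' : (f + b * a) * t' = f
  t'_mul : t' * (f + b * a) = f

theorem mul_of_supp {e f a : R} (he : e * e = e) (hf : f * f = f) (ha : a = e * a * f) :
    e * a = a ∧ a * f = a := by
  constructor
  · rw [ha, ← mul_assoc, ← mul_assoc, he]
  · rw [ha, mul_assoc, hf]

theorem mul_of_supp_zero {e f g a : R} (ha : a = e * a * f) :
    (g * e = 0 → g * a = 0) ∧ (f * g = 0 → a * g = 0) := by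
  constructor
  · intro h
    rw [ha, ← mul_assoc, ← mul_assoc, h, zero_mul, zero_mul]
  · intro h
    rw [ha, mul_assoc, h, mul_zero]

theorem VdBArrow.boalch_main {e f a b t t' : R} (h : VdBArrow e f a b t t') :
    (e + f + b) * (e + f + -(a * t')) =
      (e + f + -a) * (e + a * b + t') * (e + f + (f + b * a) * b) := by
  obtain ⟨ea, af⟩ := mul_of_supp h.ee h.ff h.a_supp
  obtain ⟨fb, be⟩ := mul_of_supp h.ff h.ee h.b_supp
  obtain ⟨ft, tf⟩ := mul_of_supp h.ff h.ff h.t'_supp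
  have fa := (mul_of_supp_zero h.a_supp).1 h.fe
  have ae := (mul_of_supp_zero h.a_supp).2 h.fe
  have eb := (mul_of_supp_zero h.b_supp).1 h.ef
  have bf := (mul_of_supp_zero h.b_supp).2 h.ef
  have et := (mul_of_supp_zero h.t'_supp).1 h.ef
  have te := (mul_of_supp_zero h.t'_supp).2 h.fe
  have aa : a * a = 0 := (mul_of_supp_zero h.a_supp).2 fa
  have h1 : b * (a * t') = f - t' := by
    have := h.mul_t'
    rw [add_mul, ft, mul_assoc] at this
    rw [← this]; abel
  have h2 : t' * ((f + b * a) * b) = b := by rw [← mul_assoc, h.t'_mul, fb]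
  have l1 : (e + f + b) * (e + f + -(a * t')) = e + t' + b - a * t' := by
    have : (e + f + b) * (e + f + -(a * t')) = (e * e + e * f + f * e + f * f) + (b * e + b * f)
      - (e * a * t' + f * a * t' + b * (a * t')) := by noncomm_ring
    rw [this, h.ee, h.ef, h.fe, h.ff, be, bf, ea, fa, h1]
    noncomm_ring
  have l2 : (e + f + -a) * (e + a * b + t') = e + a * b + t' - a * t' := by
    have : (e + f + -a) * (e + a * b + t') = e * e + f * e - a * e + e * a * b + f * a * b
      - a * a * b + e * t' + f * t' - a * t' := by noncomm_ring
    rw [this, h.ee, h.fe, ae, ea, fa, aa, et, ft]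
    noncomm_ring
  rw [l1, l2]
  have : (e + a * b + t' - a * t') * (e + f + (f + b * a) * b) =
      e * e + e * f + a * (b * e) + a * (b * f) + t' * e + t' * f - a * (t' * e) - a * (t' * f)
      + e * f * b + e * b * a * b + a * (b * f) * b + a * b * b * a * b
      + t' * ((f + b * a) * b) - a * (t' * ((f + b * a) * b)) := by noncomm_ring
  have bb : a * b * b = 0 := by rw [mul_assoc, (mul_of_supp_zero h.b_supp).2 eb, mul_zero]
  rw [this, h2, h.ee, h.ef, be, bf, te, tf, eb, bb]
  noncomm_ring

/-- The relations between the generators of the Boalch algebra of one color. -/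
structure BoalchArrow (e f v v' w w' γ γi δ δi : R) : Prop where
  ee : e * e = e
  ff : f * f = f
  ef : e * f = 0
  fe : f * e = 0
  v_supp : v = e * v * f
  v'_supp : v' = f * v' * e
  w_supp : w = e * w * f
  w'_supp : w' = f * w' * e
  γ_supp : γ = e * γ * e
  γi_supp : γi = e * γi * e
  δ_supp : δ = f * δ * f
  δi_supp : δi = f * δi * f
  γ_γi : γ * γi = e
  γi_γ : γi * γ = e
  δ_δi : δ * δi = f
  δi_δ : δi * δ = f
  main : (e + f + v') * (e + f + v) = (e + f + w) * (γ + δ) * (e + f + w')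

section

variable {e f v v' w w' γ γi δ δi : R} (h : BoalchArrow e f v v' w w' γ γi δ δi)

include h

theorem BoalchArrow.components :
    f + v' * v = δ ∧ v = w * δ ∧ v' = δ * w' ∧ e = γ + w * δ * w' := by
  obtain ⟨ev, vf⟩ := mul_of_supp h.ee h.ff h.v_supp
  obtain ⟨fv', v'e⟩ := mul_of_supp h.ff h.ee h.v'_supp
  obtain ⟨ew, wf⟩ := mul_of_supp h.ee h.ff h.w_supp
  obtain ⟨fw', w'e⟩ := mul_of_supp h.ff h.ee h.w'_supp
  obtain ⟨eγ, γe⟩ := mul_of_supp h.ee h.ee h.γ_supp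
  obtain ⟨fδ, δf⟩ := mul_of_supp h.ff h.ff h.δ_supp
  have fv := (mul_of_supp_zero h.v_supp).1 h.fe
  have ve := (mul_of_supp_zero h.v_supp).2 h.fe
  have ev' := (mul_of_supp_zero h.v'_supp).1 h.ef
  have v'f := (mul_of_supp_zero h.v'_supp).2 h.ef
  have fw := (mul_of_supp_zero h.w_supp).1 h.fe
  have we := (mul_of_supp_zero h.w_supp).2 h.fe
  have ew' := (mul_of_supp_zero h.w'_supp).1 h.ef
  have w'f := (mul_of_supp_zero h.w'_supp).2 h.ef
  have fγ := (mul_of_supp_zero h.γ_supp).1 h.fe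
  have γf := (mul_of_supp_zero h.γ_supp).2 h.ef
  have eδ := (mul_of_supp_zero h.δ_supp).1 h.ef
  have δe := (mul_of_supp_zero h.δ_supp).2 h.fe
  have key (x y : R) : (x * (e + f + v')) * ((e + f + v) * y) =
      (x * (e + f + w)) * (γ + δ) * ((e + f + w') * y) := by
    simpa only [mul_assoc] using congrArg (fun z => x * z * y) h.main
  have fL : f * (e + f + v') = f + v' := by rw [mul_add, mul_add, h.fe, h.ff, fv', zero_add]
  have fR : f * (e + f + w) = f := by rw [mul_add, mul_add, h.fe, h.ff, fw, zero_add, add_zero]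
  have eL : e * (e + f + v') = e := by rw [mul_add, mul_add, h.ee, h.ef, ev', add_zero, add_zero]
  have eR : e * (e + f + w) = e + w := by rw [mul_add, mul_add, h.ee, h.ef, ew, add_zero]
  have Lf : (e + f + v) * f = f + v := by rw [add_mul, add_mul, h.ef, h.ff, vf, zero_add]
  have Rf : (e + f + w') * f = f := by rw [add_mul, add_mul, h.ef, h.ff, w'f, zero_add, add_zero]
  have Le : (e + f + v) * e = e := by rw [add_mul, add_mul, h.ee, h.fe, ve, add_zero, add_zero]
  have Re : (e + f + w') * e = e + w' := by rw [add_mul, add_mul, h.ee, h.fe, w'e, add_zero]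
  have k1 := key f f
  have k2 := key e f
  have k3 := key f e
  have k4 := key e e
  rw [fL, Lf, fR, Rf] at k1
  rw [eL, Lf, eR, Rf] at k2
  rw [fL, Le, fR, Re] at k3
  rw [eL, Le, eR, Re] at k4
  have wγ : w * γ = 0 := by rw [← wf, mul_assoc, fγ, mul_zero]
  have γw' : γ * w' = 0 := by rw [← fw', ← mul_assoc, γf, zero_mul]
  refine ⟨?_, ?_, ?_, ?_⟩
  · simpa [mul_add, add_mul, h.ff, fv, v'f, fγ, fδ, δf] using k1
  · simpa [mul_add, add_mul, h.ef, ev, wγ, eδ, eγ, γf, δf, mul_assoc] using k2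
  · simpa [mul_add, add_mul, h.fe, v'e, fγ, fδ, δe] using k3
  · simpa [mul_add, add_mul, h.ee, wγ, γw', eγ, γe, eδ, δe, mul_assoc] using k4

theorem BoalchArrow.one_sub : e - w * v' = γ ∧ f - v' * w = δi := by
  obtain ⟨h1, h2, h3, h4⟩ := h.components
  obtain ⟨-, wf⟩ := mul_of_supp h.ee h.ff h.w_supp
  obtain ⟨fδi, -⟩ := mul_of_supp h.ff h.ff h.δi_supp
  constructor
  · rw [h3, ← mul_assoc]
    nth_rw 1 [h4]
    abel
  · have : v' * w = f - δi := by
      calc v' * w = v' * (w * δ) * δi := by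
            rw [mul_assoc, mul_assoc w, h.δ_δi, wf]
        _ = (f + v' * v - f) * δi := by rw [← h2]; noncomm_ring
        _ = f - δi := by rw [h1, sub_mul, h.δ_δi, fδi]
    rw [this]; abel

theorem BoalchArrow.sub_mul_v' : (f - v' * w) * v' = w' := by
  obtain ⟨-, -, h3, -⟩ := h.components
  obtain ⟨fw', -⟩ := mul_of_supp h.ff h.ee h.w'_supp
  rw [h.one_sub.2]
  nth_rw 1 [h3]
  rw [← mul_assoc, h.δi_δ, fw']

end

section

variable (hQ : IsOneArrow Q lo hi)

include hQ

theorem vdBArrow_of_respects {f : VGen n Q.C → R} (hf : Respects (VRel 𝕜 Q) f) (c : Q.C) :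
    VdBArrow (f (.E (lo c))) (f (.E (hi c))) (f (.A c (lo c) (hi c))) (f (.A c (hi c) (lo c)))
      (f (.T c (lo c) (hi c))) (f (.T c (hi c) (lo c))) := by
  have hne := (hQ.lt c).ne
  have h1 : Q.DArr c (lo c) (hi c) := (hQ.dArr_iff c _ _).2 (Or.inl ⟨rfl, rfl⟩)
  have h2 : Q.DArr c (hi c) (lo c) := (hQ.dArr_iff c _ _).2 (Or.inr ⟨rfl, rfl⟩)
  constructor
  · simpa using hf (VRel.orth (lo c) (lo c))
  · simpa using hf (VRel.orth (hi c) (hi c))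
  · simpa [hne] using hf (VRel.orth (lo c) (hi c))
  · simpa [hne.symm] using hf (VRel.orth (hi c) (lo c))
  · simpa using hf (VRel.asupp c _ _ h1)
  · simpa using hf (VRel.asupp c _ _ h2)
  · simpa using hf (VRel.tsupp c _ _ h1)
  · simpa using hf (VRel.tsupp c _ _ h2)
  · simpa using hf (VRel.tinv c _ _ h1)
  · simpa using hf (VRel.tinv' c _ _ h1)
  · simpa using hf (VRel.tinv c _ _ h2)
  · simpa using hf (VRel.tinv' c _ _ h2)

theorem lift_main_left (g : BGen n Q.C → R)
    (hv : ∀ c i j, ¬ ((i = lo c ∧ j = hi c) ∨ (i = hi c ∧ j = lo c)) → g (.V c i j) = 0)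
    (c : Q.C) :
    FreeAlgebra.lift 𝕜 g (vcMinus 𝕜 Q c * vcPlus 𝕜 Q c) =
      (g (.E (lo c)) + g (.E (hi c)) + g (.V c (hi c) (lo c))) *
        (g (.E (lo c)) + g (.E (hi c)) + g (.V c (lo c) (hi c))) := by
  simp only [vcMinus, vcPlus, oneIc, map_mul, map_add, map_sum, FreeAlgebra.lift_ι_apply]
  rw [hQ.sum_mem c, hQ.sum_lt c (fun i j => g (.V c i j)) (hv c),
    hQ.sum_gt c (fun i j => g (.V c i j)) (hv c)]

theorem lift_main_right (g : BGen n Q.C → R)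
    (hw : ∀ c i j, ¬ ((i = lo c ∧ j = hi c) ∨ (i = hi c ∧ j = lo c)) → g (.W c i j) = 0)
    (c : Q.C) :
    FreeAlgebra.lift 𝕜 g (wcPlus 𝕜 Q c * gamC 𝕜 Q c * wcMinus 𝕜 Q c) =
      (g (.E (lo c)) + g (.E (hi c)) + g (.W c (lo c) (hi c))) *
        (g (.G c (lo c)) + g (.G c (hi c))) *
        (g (.E (lo c)) + g (.E (hi c)) + g (.W c (hi c) (lo c))) := by
  simp only [wcMinus, wcPlus, oneIc, gamC, map_mul, map_add, map_sum, FreeAlgebra.lift_ι_apply]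
  rw [hQ.sum_mem c, hQ.sum_mem c, hQ.sum_lt c (fun i j => g (.W c i j)) (hw c),
    hQ.sum_gt c (fun i j => g (.W c i j)) (hw c)]

theorem boalchArrow_of_respects {g : BGen n Q.C → R} (hg : Respects (BoalchRel 𝕜 Q) g)
    (c : Q.C) :
    BoalchArrow (g (.E (lo c))) (g (.E (hi c))) (g (.V c (lo c) (hi c)))
      (g (.V c (hi c) (lo c))) (g (.W c (lo c) (hi c))) (g (.W c (hi c) (lo c)))
      (g (.G c (lo c))) (g (.Gi c (lo c))) (g (.G c (hi c))) (g (.Gi c (hi c))) := by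
  have hne := (hQ.lt c).ne
  have h1 : Q.DArr c (lo c) (hi c) := (hQ.dArr_iff c _ _).2 (Or.inl ⟨rfl, rfl⟩)
  have h2 : Q.DArr c (hi c) (lo c) := (hQ.dArr_iff c _ _).2 (Or.inr ⟨rfl, rfl⟩)
  have h3 := (hQ.ne_and_mem_iff c (lo c) (hi c)).2 (Or.inl ⟨rfl, rfl⟩)
  have h4 := (hQ.ne_and_mem_iff c (hi c) (lo c)).2 (Or.inr ⟨rfl, rfl⟩)
  constructor
  · simpa using hg (BoalchRel.orth (lo c) (lo c))
  · simpa using hg (BoalchRel.orth (hi c) (hi c))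
  · simpa [hne] using hg (BoalchRel.orth (lo c) (hi c))
  · simpa [hne.symm] using hg (BoalchRel.orth (hi c) (lo c))
  · simpa using hg (BoalchRel.vsupp c _ _ h1)
  · simpa using hg (BoalchRel.vsupp c _ _ h2)
  · simpa using hg (BoalchRel.wsupp c _ _ h3)
  · simpa using hg (BoalchRel.wsupp c _ _ h4)
  · simpa using hg (BoalchRel.gsupp c _ h3.2.1)
  · simpa using hg (BoalchRel.gisupp c _ h3.2.1)
  · simpa using hg (BoalchRel.gsupp c _ h3.2.2)
  · simpa using hg (BoalchRel.gisupp c _ h3.2.2)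
  · simpa using hg (BoalchRel.ginv c _ h3.2.1)
  · simpa using hg (BoalchRel.ginv' c _ h3.2.1)
  · simpa using hg (BoalchRel.ginv c _ h3.2.2)
  · simpa using hg (BoalchRel.ginv' c _ h3.2.2)
  · rw [← lift_main_left (𝕜 := 𝕜) hQ g, ← lift_main_right (𝕜 := 𝕜) hQ g]
    · exact hg (BoalchRel.main c)
    · intro c i j h
      simpa using hg (BoalchRel.wzero c i j (by rwa [hQ.ne_and_mem_iff]))
    · intro c i j h
      simpa using hg (BoalchRel.vzero c i j (by rwa [hQ.dArr_iff]))

theorem respects_boalchOfVdB {f : VGen n Q.C → R} (hf : Respects (VRel 𝕜 Q) f) :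
    Respects (BoalchRel 𝕜 Q) (boalchOfVdB lo hi f) := by
  have hne := fun c => (hQ.lt c).ne
  have hne' := fun c => (hQ.lt c).ne'
  have H := vdBArrow_of_respects hQ hf
  intro x y hxy
  cases hxy with
  | orth i j =>
    have := hf (VRel.orth i j)
    split_ifs at this ⊢ <;> simpa [boalchOfVdB] using this
  | sum_one => simpa [boalchOfVdB] using hf VRel.sum_one
  | vsupp c i j h =>
    obtain ⟨ea, af⟩ := mul_of_supp (H c).ee (H c).ff (H c).a_supp
    obtain ⟨ft, tf⟩ := mul_of_supp (H c).ff (H c).ff (H c).t'_supp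
    obtain ⟨fb, be⟩ := mul_of_supp (H c).ff (H c).ee (H c).b_supp
    rcases (hQ.dArr_iff c i j).1 h with ⟨rfl, rfl⟩ | ⟨rfl, rfl⟩
    · simp [boalchOfVdB, mul_assoc, tf, ← mul_assoc _ (f (.A c _ _)), ea]
    · simp [boalchOfVdB, hne', fb, be]
  | vzero c i j h =>
    rw [hQ.dArr_iff, not_or] at h
    simp [boalchOfVdB, h.1, h.2]
  | wsupp c i j h =>
    obtain ⟨ea, af⟩ := mul_of_supp (H c).ee (H c).ff (H c).a_supp
    obtain ⟨fb, be⟩ := mul_of_supp (H c).ff (H c).ee (H c).b_supp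
    rcases (hQ.ne_and_mem_iff c i j).1 h with ⟨rfl, rfl⟩ | ⟨rfl, rfl⟩
    · simp [boalchOfVdB, ea, af]
    · simp only [FreeAlgebra.lift_ι_apply, boalchOfVdB, hne', hne, if_false, and_self,
        if_true, map_mul]
      rw [mul_assoc, mul_assoc _ _ (f (.E (lo c))), be, ← mul_assoc, mul_add, ← mul_assoc, fb,
        (H c).ff]
  | wzero c i j h =>
    rw [hQ.ne_and_mem_iff, not_or] at h
    simp [boalchOfVdB, h.1, h.2]
  | gsupp c i h =>
    obtain ⟨ea, af⟩ := mul_of_supp (H c).ee (H c).ff (H c).a_supp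
    obtain ⟨fb, be⟩ := mul_of_supp (H c).ff (H c).ee (H c).b_supp
    rcases (hQ.mem_iff c i).1 h with rfl | rfl
    · simp only [FreeAlgebra.lift_ι_apply, boalchOfVdB, if_true, map_mul]
      rw [mul_add, (H c).ee, ← mul_assoc, ea, add_mul, (H c).ee, mul_assoc, be]
    · simpa [boalchOfVdB, hne'] using (H c).t'_supp
  | gzero c i h =>
    rw [hQ.mem_iff, not_or] at h
    simp [boalchOfVdB, h.1, h.2]
  | gisupp c i h =>
    obtain ⟨ea, af⟩ := mul_of_supp (H c).ee (H c).ff (H c).a_supp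
    obtain ⟨fb, be⟩ := mul_of_supp (H c).ff (H c).ee (H c).b_supp
    rcases (hQ.mem_iff c i).1 h with rfl | rfl
    · simpa [boalchOfVdB] using (H c).t_supp
    · simp only [FreeAlgebra.lift_ι_apply, boalchOfVdB, hne', if_false, if_true, map_mul]
      rw [mul_add, (H c).ff, ← mul_assoc, fb, add_mul, (H c).ff, mul_assoc, af]
  | gizero c i h =>
    rw [hQ.mem_iff, not_or] at h
    simp [boalchOfVdB, h.1, h.2]
  | ginv c i h =>
    rcases (hQ.mem_iff c i).1 h with rfl | rfl
    · simpa [boalchOfVdB] using (H c).mul_t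
    · simpa [boalchOfVdB, hne'] using (H c).t'_mul
  | ginv' c i h =>
    rcases (hQ.mem_iff c i).1 h with rfl | rfl
    · simpa [boalchOfVdB] using (H c).t_mul
    · simpa [boalchOfVdB, hne'] using (H c).mul_t'
  | main c =>
    rw [lift_main_left hQ, lift_main_right hQ]
    · simpa [boalchOfVdB, hne'] using (H c).boalch_main
    · intro c i j h
      rw [not_or] at h
      simp [boalchOfVdB, h.1, h.2]
    · intro c i j h
      rw [not_or] at h
      simp [boalchOfVdB, h.1, h.2]

theorem respects_vdBOfBoalch {g : BGen n Q.C → R} (hg : Respects (BoalchRel 𝕜 Q) g) :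
    Respects (VRel 𝕜 Q) (vdBOfBoalch lo hi g) := by
  have hne := fun c => (hQ.lt c).ne
  have hne' := fun c => (hQ.lt c).ne'
  have H := boalchArrow_of_respects hQ hg
  intro x y hxy
  cases hxy with
  | orth i j =>
    have := hg (BoalchRel.orth i j)
    split_ifs at this ⊢ <;> simpa [vdBOfBoalch] using this
  | sum_one => simpa [vdBOfBoalch] using hg BoalchRel.sum_one
  | asupp c i j h =>
    rcases (hQ.dArr_iff c i j).1 h with ⟨rfl, rfl⟩ | ⟨rfl, rfl⟩
    · simpa [vdBOfBoalch] using (H c).w_supp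
    · simpa [vdBOfBoalch, hne'] using (H c).v'_supp
  | azero c i j h =>
    rw [hQ.dArr_iff, not_or] at h
    simp [vdBOfBoalch, h.1, h.2]
  | tsupp c i j h =>
    rcases (hQ.dArr_iff c i j).1 h with ⟨rfl, rfl⟩ | ⟨rfl, rfl⟩
    · simpa [vdBOfBoalch] using (H c).γi_supp
    · simpa [vdBOfBoalch, hne'] using (H c).δ_supp
  | tzero c i j h =>
    rw [hQ.dArr_iff, not_or] at h
    simp [vdBOfBoalch, h.1, h.2]
  | tinv c i j h =>
    rcases (hQ.dArr_iff c i j).1 h with ⟨rfl, rfl⟩ | ⟨rfl, rfl⟩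
    · simpa [vdBOfBoalch, hne', ← sub_eq_add_neg, (H c).one_sub.1] using (H c).γ_γi
    · simpa [vdBOfBoalch, hne', ← sub_eq_add_neg, (H c).one_sub.2] using (H c).δi_δ
  | tinv' c i j h =>
    rcases (hQ.dArr_iff c i j).1 h with ⟨rfl, rfl⟩ | ⟨rfl, rfl⟩
    · simpa [vdBOfBoalch, hne', ← sub_eq_add_neg, (H c).one_sub.1] using (H c).γi_γ
    · simpa [vdBOfBoalch, hne', ← sub_eq_add_neg, (H c).one_sub.2] using (H c).δ_δi

theorem vdBOfBoalch_boalchOfVdB {f : VGen n Q.C → R} (hf : Respects (VRel 𝕜 Q) f)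
    (x : VGen n Q.C) : vdBOfBoalch lo hi (boalchOfVdB lo hi f) x = f x := by
  have hne' := fun c => (hQ.lt c).ne'
  cases x with
  | E i => rfl
  | A c i j =>
    by_cases h : Q.DArr c i j
    · rcases (hQ.dArr_iff c i j).1 h with ⟨rfl, rfl⟩ | ⟨rfl, rfl⟩ <;>
        simp [vdBOfBoalch, boalchOfVdB, hne']
    · have := hf (VRel.azero c i j h)
      rw [hQ.dArr_iff, not_or] at h
      simpa [vdBOfBoalch, h.1, h.2] using this.symm
  | T c i j =>
    by_cases h : Q.DArr c i j
    · rcases (hQ.dArr_iff c i j).1 h with ⟨rfl, rfl⟩ | ⟨rfl, rfl⟩ <;>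
        simp [vdBOfBoalch, boalchOfVdB, hne']
    · have := hf (VRel.tzero c i j h)
      rw [hQ.dArr_iff, not_or] at h
      simpa [vdBOfBoalch, h.1, h.2] using this.symm

theorem boalchOfVdB_vdBOfBoalch {g : BGen n Q.C → R} (hg : Respects (BoalchRel 𝕜 Q) g)
    (x : BGen n Q.C) : boalchOfVdB lo hi (vdBOfBoalch lo hi g) x = g x := by
  have hne' := fun c => (hQ.lt c).ne'
  have H := boalchArrow_of_respects hQ hg
  cases x with
  | E i => rfl
  | V c i j =>
    by_cases h : Q.DArr c i j
    · rcases (hQ.dArr_iff c i j).1 h with ⟨rfl, rfl⟩ | ⟨rfl, rfl⟩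
      · simpa [vdBOfBoalch, boalchOfVdB, hne'] using (H c).components.2.1.symm
      · simp [vdBOfBoalch, boalchOfVdB, hne']
    · have := hg (BoalchRel.vzero c i j h)
      rw [hQ.dArr_iff, not_or] at h
      simpa [boalchOfVdB, h.1, h.2] using this.symm
  | W c i j =>
    by_cases h : i ≠ j ∧ i ∈ Q.mem c ∧ j ∈ Q.mem c
    · rcases (hQ.ne_and_mem_iff c i j).1 h with ⟨rfl, rfl⟩ | ⟨rfl, rfl⟩
      · simp [vdBOfBoalch, boalchOfVdB]
      · simpa [vdBOfBoalch, boalchOfVdB, hne', ← sub_eq_add_neg] using (H c).sub_mul_v'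
    · have := hg (BoalchRel.wzero c i j h)
      rw [hQ.ne_and_mem_iff, not_or] at h
      simpa [boalchOfVdB, h.1, h.2] using this.symm
  | G c i =>
    by_cases h : i ∈ Q.mem c
    · rcases (hQ.mem_iff c i).1 h with rfl | rfl
      · simpa [vdBOfBoalch, boalchOfVdB, hne', ← sub_eq_add_neg] using (H c).one_sub.1
      · simp [vdBOfBoalch, boalchOfVdB, hne']
    · have := hg (BoalchRel.gzero c i h)
      rw [hQ.mem_iff, not_or] at h
      simpa [boalchOfVdB, h.1, h.2] using this.symm
  | Gi c i =>
    by_cases h : i ∈ Q.mem c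
    · rcases (hQ.mem_iff c i).1 h with rfl | rfl
      · simp [vdBOfBoalch, boalchOfVdB]
      · simpa [vdBOfBoalch, boalchOfVdB, hne', ← sub_eq_add_neg] using (H c).one_sub.2
    · have := hg (BoalchRel.gizero c i h)
      rw [hQ.mem_iff, not_or] at h
      simpa [boalchOfVdB, h.1, h.2] using this.symm

/-- The generator translations induce an isomorphism between any two quotients of `B(Υ)` and
`A(Υ)` whose relations correspond to each other. -/
theorem exists_algEquiv_of_oneArrow
    {r : FreeAlgebra 𝕜 (BGen n Q.C) → FreeAlgebra 𝕜 (BGen n Q.C) → Prop}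
    {r' : FreeAlgebra 𝕜 (VGen n Q.C) → FreeAlgebra 𝕜 (VGen n Q.C) → Prop}
    (hr : ∀ ⦃x y⦄, BoalchRel 𝕜 Q x y → r x y) (hr' : ∀ ⦃x y⦄, VRel 𝕜 Q x y → r' x y)
    (hB : Respects r (boalchOfVdB lo hi (gen r')))
    (hV : Respects r' (vdBOfBoalch lo hi (gen r))) :
    ∃ φ : RingQuot r ≃ₐ[𝕜] RingQuot r', ∀ i, φ (gen r (.E i)) = gen r' (.E i) := by
  have hgr : Respects (BoalchRel 𝕜 Q) (gen r) := fun x y h => respects_gen r (hr h)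
  have hgr' : Respects (VRel 𝕜 Q) (gen r') := fun x y h => respects_gen r' (hr' h)
  obtain ⟨φ, hφ⟩ := exists_algEquiv_of_respects hB hV
    (fun x => by
      rw [map_boalchOfVdB]
      simp only [descend_gen]
      exact boalchOfVdB_vdBOfBoalch hQ hgr x)
    (fun y => by
      rw [map_vdBOfBoalch]
      simp only [descend_gen]
      exact vdBOfBoalch_boalchOfVdB hQ hgr' y)
  exact ⟨φ, fun i => hφ (.E i)⟩

theorem lift_mom_boalchOfVdB (f : VGen n Q.C → R) (s : Fin n) (l : List (Q.C × Fin n))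
    (hl : ∀ cj ∈ l, Q.DArr cj.1 s cj.2) :
    FreeAlgebra.lift 𝕜 (boalchOfVdB lo hi f)
        (((l.map Prod.fst).map (fun c => bfG 𝕜 Q c s)).prod) =
      FreeAlgebra.lift 𝕜 f ((l.map (fun cj =>
          if s < cj.2 then vfE 𝕜 Q s + vfA 𝕜 Q cj.1 s cj.2 * vfA 𝕜 Q cj.1 cj.2 s
          else vfT 𝕜 Q cj.1 s cj.2)).prod) := by
  rw [map_list_prod, map_list_prod, List.map_map, List.map_map, List.map_map]
  congr 1
  refine List.map_congr_left ?_
  rintro ⟨c, j⟩ hcj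
  have hlt := hQ.lt c
  rcases (hQ.dArr_iff c s j).1 (hl _ hcj) with ⟨rfl, rfl⟩ | ⟨rfl, rfl⟩
  · simp [boalchOfVdB, hlt]
  · simp [boalchOfVdB, hlt.ne', hlt.not_gt]

theorem exists_fission_algEquiv_mpa (q : Fin n → 𝕜ˣ) (ordArr : Fin n → List (Q.C × Fin n))
    (hA : ∀ s, ∀ cj ∈ ordArr s, Q.DArr cj.1 s cj.2) :
    ∃ ψ : Fission 𝕜 Q q (fun s => (ordArr s).map Prod.fst) ≃ₐ[𝕜] MPA 𝕜 Q q ordArr,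
      ∀ i : Fin n, ψ (fissE 𝕜 Q q _ i) = mpaE 𝕜 Q q ordArr i := by
  refine exists_algEquiv_of_oneArrow hQ (fun _ _ h => FissRel.base h) (fun _ _ h => MPARel.base h)
    ?_ ?_
  · have h0 := respects_gen (MPARel 𝕜 Q q ordArr)
    intro x y hxy
    cases hxy with
    | base h => exact respects_boalchOfVdB hQ (fun _ _ h' => h0 (MPARel.base h')) h
    | mom s =>
      rw [lift_mom_boalchOfVdB hQ _ _ _ (hA s), h0 (MPARel.mom s)]
      simp [boalchOfVdB]
  · have h0 := respects_gen (FissRel 𝕜 Q q (fun s => (ordArr s).map Prod.fst))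
    have h1 : Respects (BoalchRel 𝕜 Q) _ := fun _ _ h' => h0 (FissRel.base h')
    intro x y hxy
    cases hxy with
    | base h => exact respects_vdBOfBoalch hQ h1 h
    | mom s =>
      rw [← lift_mom_boalchOfVdB hQ _ _ _ (hA s),
        funext (boalchOfVdB_vdBOfBoalch hQ h1), h0 (FissRel.mom s)]
      simp [vdBOfBoalch]

end

end OneArrow

section Reordering

variable {𝕜 : Type} [Field 𝕜] {n : ℕ} {Q : ColoredQuiver n} {R : Type} [Ring R] [Algebra 𝕜 R]

/-- Conjugation by a unit, as an algebra endomorphism. -/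
def conjAlgHom (u : Rˣ) : R →ₐ[𝕜] R where
  toFun x := u * x * ↑u⁻¹
  map_one' := by simp
  map_mul' x y := by simp [mul_assoc]
  map_zero' := by simp
  map_add' x y := by simp [mul_add, add_mul]
  commutes' r := by rw [← Algebra.commutes, mul_assoc, u.mul_inv, mul_one]

theorem conjAlgHom_apply (u : Rˣ) (x : R) :
    conjAlgHom (𝕜 := 𝕜) u x = u * x * ↑u⁻¹ := rfl

/-- Conjugate the generators of color `a` by the unit `u`, fixing all other generators. -/
def conjColor (a : Q.C) (u : Rˣ) (g : BGen n Q.C → R) : BGen n Q.C → R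
  | .E i => g (.E i)
  | .V c i j => if c = a then u * g (.V c i j) * ↑u⁻¹ else g (.V c i j)
  | .W c i j => if c = a then u * g (.W c i j) * ↑u⁻¹ else g (.W c i j)
  | .G c i => if c = a then u * g (.G c i) * ↑u⁻¹ else g (.G c i)
  | .Gi c i => if c = a then u * g (.Gi c i) * ↑u⁻¹ else g (.Gi c i)

theorem respects_conjColor {a : Q.C} {u : Rˣ} {g : BGen n Q.C → R}
    (hu : ∀ i, u * g (.E i) * ↑u⁻¹ = g (.E i)) (hg : Respects (BoalchRel 𝕜 Q) g) :
    Respects (BoalchRel 𝕜 Q) (conjColor a u g) := by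
  let σ (c : Q.C) : R →ₐ[𝕜] R := if c = a then conjAlgHom u else AlgHom.id 𝕜 R
  have hE (c i) : σ c (g (.E i)) = conjColor a u g (.E i) := by
    by_cases h : c = a <;> simp [σ, h, conjAlgHom_apply, hu, conjColor]
  have hV (c i j) : σ c (g (.V c i j)) = conjColor a u g (.V c i j) := by
    by_cases h : c = a <;> simp [σ, h, conjAlgHom_apply, conjColor]
  have hW (c i j) : σ c (g (.W c i j)) = conjColor a u g (.W c i j) := by
    by_cases h : c = a <;> simp [σ, h, conjAlgHom_apply, conjColor]
  have hG (c i) : σ c (g (.G c i)) = conjColor a u g (.G c i) := by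
    by_cases h : c = a <;> simp [σ, h, conjAlgHom_apply, conjColor]
  have hGi (c i) : σ c (g (.Gi c i)) = conjColor a u g (.Gi c i) := by
    by_cases h : c = a <;> simp [σ, h, conjAlgHom_apply, conjColor]
  intro x y hxy
  cases hxy with
  | orth i j =>
    have := hg (BoalchRel.orth i j)
    split_ifs at this ⊢ <;> simpa [conjColor] using this
  | sum_one => simpa [conjColor] using hg BoalchRel.sum_one
  | vsupp c i j h =>
    simpa [hE, hV] using congrArg (σ c) (hg (BoalchRel.vsupp c i j h))
  | vzero c i j h =>
    simpa [hE, hV] using congrArg (σ c) (hg (BoalchRel.vzero c i j h))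
  | wsupp c i j h =>
    simpa [hE, hW] using congrArg (σ c) (hg (BoalchRel.wsupp c i j h))
  | wzero c i j h =>
    simpa [hE, hW] using congrArg (σ c) (hg (BoalchRel.wzero c i j h))
  | gsupp c i h =>
    simpa [hE, hG] using congrArg (σ c) (hg (BoalchRel.gsupp c i h))
  | gzero c i h =>
    simpa [hE, hG] using congrArg (σ c) (hg (BoalchRel.gzero c i h))
  | gisupp c i h =>
    simpa [hE, hGi] using congrArg (σ c) (hg (BoalchRel.gisupp c i h))
  | gizero c i h =>
    simpa [hE, hGi] using congrArg (σ c) (hg (BoalchRel.gizero c i h))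
  | ginv c i h =>
    simpa [hE, hG, hGi] using congrArg (σ c) (hg (BoalchRel.ginv c i h))
  | ginv' c i h =>
    simpa [hE, hG, hGi] using congrArg (σ c) (hg (BoalchRel.ginv' c i h))
  | main c =>
    simpa [hE, hV, hW, hG, vcMinus, vcPlus, wcMinus, wcPlus, oneIc, gamC] using
      congrArg (σ c) (hg (BoalchRel.main c))

/-- The unit `γ_{b,s} + (1 - e_s)`. -/
def loopUnit (g : BGen n Q.C → R) (hg : Respects (BoalchRel 𝕜 Q) g) (b : Q.C) (s : Fin n)
    (hs : s ∈ Q.mem b) : Rˣ :=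
  have hE : g (.E s) * g (.E s) = g (.E s) := by simpa using hg (BoalchRel.orth s s)
  have hG := mul_of_supp hE hE (by simpa using hg (BoalchRel.gsupp b s hs))
  have hGi := mul_of_supp hE hE (by simpa using hg (BoalchRel.gisupp b s hs))
  { val := g (.G b s) + (1 - g (.E s))
    inv := g (.Gi b s) + (1 - g (.E s))
    val_inv := by
      have h : g (.G b s) * g (.Gi b s) = g (.E s) := by simpa using hg (BoalchRel.ginv b s hs)
      simp only [mul_add, add_mul, mul_sub, sub_mul, mul_one, one_mul, h, hG.2, hGi.1, hE]
      abel
    inv_val := by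
      have h : g (.Gi b s) * g (.G b s) = g (.E s) := by simpa using hg (BoalchRel.ginv' b s hs)
      simp only [mul_add, add_mul, mul_sub, sub_mul, mul_one, one_mul, h, hG.1, hGi.2, hE]
      abel }

section

variable {g : BGen n Q.C → R} (hg : Respects (BoalchRel 𝕜 Q) g) {b : Q.C} {s : Fin n}
  (hs : s ∈ Q.mem b)

theorem loopUnit_val : (loopUnit g hg b s hs : R) = g (.G b s) + (1 - g (.E s)) := rfl

include hg in
theorem idem_mul (i j : Fin n) : g (.E i) * g (.E j) = if i = j then g (.E i) else 0 := by
  have := hg (BoalchRel.orth i j)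
  split_ifs at this ⊢ with h <;> simpa [h] using this

include hg in
theorem idem_mul_loop (c : Q.C) (i : Fin n) :
    g (.E i) * g (.G c i) = g (.G c i) ∧ g (.G c i) * g (.E i) = g (.G c i) := by
  by_cases h : i ∈ Q.mem c
  · have hE : g (.E i) * g (.E i) = g (.E i) := by simpa using idem_mul hg i i
    exact mul_of_supp hE hE (by simpa using hg (BoalchRel.gsupp c i h))
  · have : g (.G c i) = 0 := by simpa using hg (BoalchRel.gzero c i h)
    simp [this]

theorem loopUnit_mul_idem (i : Fin n) :
    loopUnit g hg b s hs * g (.E i) = if i = s then g (.G b s) else g (.E i) := by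
  rw [loopUnit_val]
  have h1 := idem_mul hg s i
  obtain ⟨-, h2⟩ := idem_mul_loop hg b s
  by_cases h : i = s
  · subst h
    simp only [if_true] at h1 ⊢
    rw [add_mul, sub_mul, h1, h2]
    simp
  · simp only [h, Ne.symm h, if_false] at h1 ⊢
    rw [add_mul, sub_mul, h1, ← h2, mul_assoc, h1]
    simp

theorem idem_mul_loopUnit (i : Fin n) :
    g (.E i) * loopUnit g hg b s hs = if i = s then g (.G b s) else g (.E i) := by
  rw [loopUnit_val]
  have h1 := idem_mul hg i s
  obtain ⟨h2, -⟩ := idem_mul_loop hg b s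
  by_cases h : i = s
  · subst h
    simp only [if_true] at h1 ⊢
    rw [mul_add, mul_sub, h1, h2]
    simp
  · simp only [h, if_false] at h1 ⊢
    rw [mul_add, mul_sub, h1, ← h2, ← mul_assoc, h1]
    simp

theorem commute_loopUnit_idem (i : Fin n) : Commute (loopUnit g hg b s hs : R) (g (.E i)) := by
  rw [Commute, SemiconjBy, loopUnit_mul_idem, idem_mul_loopUnit]

theorem conj_loopUnit_idem (i : Fin n) :
    loopUnit g hg b s hs * g (.E i) * ((loopUnit g hg b s hs)⁻¹ : Rˣ) = g (.E i) := by
  rw [(commute_loopUnit_idem hg hs i).eq, mul_assoc, Units.mul_inv, mul_one]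

theorem conj_inv_loopUnit_idem (i : Fin n) :
    ((loopUnit g hg b s hs)⁻¹ : Rˣ) * g (.E i) * (loopUnit g hg b s hs) = g (.E i) := by
  rw [mul_assoc, ← (commute_loopUnit_idem hg hs i).eq, ← mul_assoc, Units.inv_mul, one_mul]

theorem commute_loopUnit_loop (c : Q.C) {t : Fin n} (ht : t ≠ s) :
    Commute (loopUnit g hg b s hs : R) (g (.G c t)) := by
  obtain ⟨h1, h2⟩ := idem_mul_loop hg c t
  have h3 := loopUnit_mul_idem hg hs t
  have h4 := idem_mul_loopUnit hg hs t
  rw [if_neg ht] at h3 h4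
  rw [Commute, SemiconjBy]
  conv_lhs => rw [← h1, ← mul_assoc, h3, h1]
  conv_rhs => rw [← h2, mul_assoc, h4, h2]

end

theorem conjColor_loop_of_commute {a c : Q.C} {u : Rˣ} {g : BGen n Q.C → R} {t : Fin n}
    (h : c = a → Commute (u : R) (g (.G c t))) :
    conjColor a u g (.G c t) = g (.G c t) := by
  simp only [conjColor]
  split_ifs with hc
  · rw [(h hc).eq, mul_assoc, Units.mul_inv, mul_one]
  · rfl

/-- Evaluation of the moment element at `s` with factors ordered by `l`. -/
theorem lift_mom (g : BGen n Q.C → R) (s : Fin n) (l : List Q.C) :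
    FreeAlgebra.lift 𝕜 g ((l.map (fun c => bfG 𝕜 Q c s)).prod) =
      (l.map (fun c => g (.G c s))).prod := by
  rw [map_list_prod, List.map_map]
  congr 1
  exact List.map_congr_left (fun c _ => by simp)

theorem respects_fissRel_iff (q : Fin n → 𝕜ˣ) (o : Fin n → List Q.C) (g : BGen n Q.C → R) :
    Respects (FissRel 𝕜 Q q o) g ↔ Respects (BoalchRel 𝕜 Q) g ∧
      ∀ s, ((o s).map (fun c => g (.G c s))).prod = (q s : 𝕜) • g (.E s) := by
  constructor
  · intro h
    refine ⟨fun _ _ h' => h (FissRel.base h'), fun s => ?_⟩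
    rw [← lift_mom (𝕜 := 𝕜), h (FissRel.mom s)]
    simp
  · rintro ⟨h1, h2⟩ x y hxy
    cases hxy with
    | base h => exact h1 h
    | mom s =>
      rw [lift_mom, h2]
      simp

variable (𝕜 Q) in
/-- The fission algebras for two orders of the colors are isomorphic over the idempotents. -/
def FissionIso (q : Fin n → 𝕜ˣ) (o o' : Fin n → List Q.C) : Prop :=
  ∃ ψ : Fission 𝕜 Q q o ≃ₐ[𝕜] Fission 𝕜 Q q o', ∀ i, ψ (fissE 𝕜 Q q o i) = fissE 𝕜 Q q o' i

theorem FissionIso.refl (q : Fin n → 𝕜ˣ) (o : Fin n → List Q.C) : FissionIso 𝕜 Q q o o :=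
  ⟨AlgEquiv.refl, fun _ => rfl⟩

theorem FissionIso.trans {q : Fin n → 𝕜ˣ} {o o' o'' : Fin n → List Q.C}
    (h : FissionIso 𝕜 Q q o o') (h' : FissionIso 𝕜 Q q o' o'') : FissionIso 𝕜 Q q o o'' := by
  obtain ⟨ψ, hψ⟩ := h
  obtain ⟨ψ', hψ'⟩ := h'
  exact ⟨ψ.trans ψ', fun i => by simp [hψ, hψ']⟩

/-- Moving `γ_{a,s}` past the adjacent `γ_{b,s}` in the moment product is absorbed by conjugating
the arrows of color `a` with `γ_{b,s}`. -/
theorem fissionIso_of_swap {q : Fin n → 𝕜ˣ} {o o' : Fin n → List Q.C} {s : Fin n} {a b : Q.C}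
    {l₁ l₂ : List Q.C} (hab : a ≠ b) (hs : s ∈ Q.mem b) (ho : o s = l₁ ++ a :: b :: l₂)
    (ho' : o' s = l₁ ++ b :: a :: l₂) (hoo' : ∀ t, t ≠ s → o t = o' t)
    (h₁ : a ∉ l₁) (h₂ : a ∉ l₂) : FissionIso 𝕜 Q q o o' := by
  have hg := respects_gen (FissRel 𝕜 Q q o)
  have hg' := respects_gen (FissRel 𝕜 Q q o')
  obtain ⟨hgB, hgM⟩ := (respects_fissRel_iff q o _).1 hg
  obtain ⟨hgB', hgM'⟩ := (respects_fissRel_iff q o' _).1 hg'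
  set g := gen (FissRel 𝕜 Q q o)
  set g' := gen (FissRel 𝕜 Q q o')
  set u := loopUnit g hgB b s hs with hu
  set u' := loopUnit g' hgB' b s hs with hu'
  have hconj {S : Type} [Ring S] (f : BGen n Q.C → S) (v : Sˣ) (l : List Q.C) (hl : a ∉ l) :
      l.map (fun c => conjColor a v f (.G c s)) = l.map (fun c => f (.G c s)) :=
    List.map_congr_left fun c hc => by
      have : c ≠ a := by rintro rfl; exact hl hc
      simp [conjColor, this]
  have H : Respects (FissRel 𝕜 Q q o) (conjColor a u' g') := by
    refine (respects_fissRel_iff q o _).2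
      ⟨respects_conjColor (conj_loopUnit_idem hgB' hs) hgB', fun t => ?_⟩
    by_cases ht : t = s
    · subst ht
      have := hgM' t
      rw [ho'] at this
      rw [ho]
      simp only [List.map_append, List.map_cons, List.prod_append, List.prod_cons,
        hconj _ _ _ h₁, hconj _ _ _ h₂] at this ⊢
      simp only [conjColor, if_true, hab.symm, if_false]
      rw [← this]
      have hb : g' (.G b t) = g' (.E t) * u' := by rw [idem_mul_loopUnit]; simp
      have hb' : g' (.G b t) = u' * g' (.E t) := by rw [loopUnit_mul_idem]; simp
      obtain ⟨e1, e2⟩ := idem_mul_loop hgB' a t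
      have k1 : u' * g' (.G a t) = g' (.G b t) * g' (.G a t) := by rw [hb', mul_assoc, e1]
      have k2 : (↑u'⁻¹ : Fission 𝕜 Q q o') * g' (.G b t) = g' (.E t) := by
        rw [hb', Units.inv_mul_cancel_left]
      congr 1
      rw [k1]
      simp only [← mul_assoc]
      rw [mul_assoc (g' (.G b t) * _), k2, mul_assoc (g' (.G b t)), e2]
    · rw [hoo' t ht, show conjColor a u' g' (.E t) = g' (.E t) from rfl, ← hgM' t]
      congr 1
      exact List.map_congr_left fun c _ =>
        conjColor_loop_of_commute fun _ => commute_loopUnit_loop hgB' hs c ht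
  have H' : Respects (FissRel 𝕜 Q q o') (conjColor a u⁻¹ g) := by
    refine (respects_fissRel_iff q o' _).2
      ⟨respects_conjColor (by simpa using conj_inv_loopUnit_idem hgB hs) hgB, fun t => ?_⟩
    by_cases ht : t = s
    · subst ht
      have := hgM t
      rw [ho] at this
      rw [ho']
      simp only [List.map_append, List.map_cons, List.prod_append, List.prod_cons,
        hconj _ _ _ h₁, hconj _ _ _ h₂] at this ⊢
      simp only [conjColor, if_true, hab.symm, if_false, inv_inv]
      rw [← this]
      have hb : g (.G b t) = g (.E t) * u := by rw [idem_mul_loopUnit]; simp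
      obtain ⟨e1, e2⟩ := idem_mul_loop hgB a t
      have k1 : g (.G b t) * (↑u⁻¹ : Fission 𝕜 Q q o) = g (.E t) := by
        rw [hb, Units.mul_inv_cancel_right]
      have k2 : g (.G a t) * u = g (.G a t) * g (.G b t) := by rw [hb, ← mul_assoc, e2]
      congr 1
      simp only [← mul_assoc]
      rw [k1, e1, k2]
    · rw [← hoo' t ht, show conjColor a u⁻¹ g (.E t) = g (.E t) from rfl, ← hgM t]
      congr 1
      exact List.map_congr_left fun c _ =>
        conjColor_loop_of_commute fun _ => (commute_loopUnit_loop hgB hs c ht).units_inv_left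
  have hdu : Units.map (descend H').toMonoidHom u' = u := by
    ext
    simp only [Units.coe_map]
    change descend H' (g' (.G b s) + (1 - g' (.E s))) = _
    simp only [map_add, map_sub, map_one]
    rw [descend_gen H', descend_gen H']
    simp [conjColor, hab.symm, hu, loopUnit_val]
  have hdu' : Units.map (descend H).toMonoidHom u = u' := by
    ext
    simp only [Units.coe_map]
    change descend H (g (.G b s) + (1 - g (.E s))) = _
    simp only [map_add, map_sub, map_one]
    rw [descend_gen H, descend_gen H]
    simp [conjColor, hab.symm, hu', loopUnit_val]
  have hd1 : descend H' u' = u := congrArg Units.val hdu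
  have hd2 : descend H' ↑u'⁻¹ = ↑u⁻¹ := 
    congrArg (fun v : (Fission 𝕜 Q q o)ˣ => ((v⁻¹ : _ˣ) : Fission 𝕜 Q q o)) hdu
  have hd1' : descend H u = u' := congrArg Units.val hdu'
  have hd2' : descend H ↑u⁻¹ = ↑u'⁻¹ := 
    congrArg (fun v : (Fission 𝕜 Q q o')ˣ => ((v⁻¹ : _ˣ) : Fission 𝕜 Q q o')) hdu'
  have hval (x) : descend H' (g' x) = conjColor a u⁻¹ g x := descend_gen H' x
  have hval' (x) : descend H (g x) = conjColor a u' g' x := descend_gen H x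
  obtain ⟨φ, hφ⟩ := exists_algEquiv_of_respects H H'
    (fun x => by
      change descend H' (conjColor a u' g' x) = g x
      cases x
      case E => simp [hval, conjColor]
      all_goals
        simp only [conjColor]
        split_ifs with hc <;> simp [hval, conjColor, hc, hd1, hd2, mul_assoc])
    (fun x => by
      change descend H (conjColor a u⁻¹ g x) = g' x
      cases x
      case E => simp [hval', conjColor]
      all_goals
        simp only [conjColor]
        split_ifs with hc <;> simp [hval', conjColor, hc, hd1', hd2', mul_assoc])
  exact ⟨φ, fun i => hφ (.E i)⟩

theorem fissionIso_update_of_perm (q : Fin n → 𝕜ˣ) (o : Fin n → List Q.C) (s : Fin n)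
    {l l' : List Q.C} (hp : l.Perm l') :
    ∀ p : List Q.C, (p ++ l).Nodup → (∀ c ∈ l, s ∈ Q.mem c) →
      FissionIso 𝕜 Q q (Function.update o s (p ++ l)) (Function.update o s (p ++ l')) := by
  induction hp with
  | nil => exact fun p _ _ => FissionIso.refl q _
  | cons x _ ih =>
    intro p hn hm
    simpa using ih (p ++ [x]) (by simpa using hn) (fun c hc => hm c (List.mem_cons_of_mem _ hc))
  | swap x y l =>
    intro p hn hm
    have hn' := hn
    simp only [List.nodup_append, List.nodup_cons, List.mem_cons, not_or] at hn'
    exact fissionIso_of_swap (s := s) (a := y) (b := x) (l₁ := p) (l₂ := l) hn'.2.1.1.1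
      (hm x (by simp)) (by simp) (by simp) (fun t ht => by simp [ht])
      (fun h => hn'.2.2 y h y (by simp) rfl) hn'.2.1.1.2
  | trans h1 _ ih1 ih2 =>
    intro p hn hm
    exact (ih1 p hn hm).trans (ih2 p ((h1.append_left p).nodup_iff.1 hn)
      (fun c hc => hm c (h1.mem_iff.2 hc)))

theorem fissionIso_of_perm (q : Fin n → 𝕜ˣ) {o o' : Fin n → List Q.C}
    (hn : ∀ s, (o s).Nodup) (hm : ∀ s, ∀ c ∈ o s, s ∈ Q.mem c) (hp : ∀ s, (o s).Perm (o' s)) :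
    FissionIso 𝕜 Q q o o' := by
  have key (F : Finset (Fin n)) : FissionIso 𝕜 Q q o (F.piecewise o' o) := by
    induction F using Finset.induction_on with
    | empty => simpa using FissionIso.refl q o
    | insert s F hs ih =>
      refine ih.trans ?_
      have := fissionIso_update_of_perm q (F.piecewise o' o) s (hp s) [] (by simpa using hn s)
        (hm s)
      rw [Finset.piecewise_insert]
      convert this using 1 <;> simp [hs]
  simpa using key Finset.univ

end Reordering

/-- Lemma 3.7. Let `Υ` be a colored quiver in which each
monochromatic subquiver consists of exactly one arrow. Then there are isomorphisms of
algebras over `B` (i.e. `𝕜`-algebra isomorphisms matching the vertex idempotents)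
`B(Υ) ≅ A(Υ)` and, for every parameter `q ∈ (𝕜^×)^I`, `F^q(Υ) ≅ Λ^q(Υ)`. -/
theorem statement_1 (𝕜 : Type) [Field 𝕜] [CharZero 𝕜] {n : ℕ} (Q : ColoredQuiver n)
    (hone : ∀ c : Q.C, ∃ i j : Fin n,
      i < j ∧ Q.mem c = {i, j} ∧ Q.part c i ≠ Q.part c j) :
    (∃ φ : Boalch 𝕜 Q ≃ₐ[𝕜] VdBAlg 𝕜 Q, ∀ i : Fin n, φ (bE 𝕜 Q i) = vE 𝕜 Q i)
    ∧ ∀ (q : Fin n → 𝕜ˣ) (ordCol : Fin n → List Q.C)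
        (ordArr : Fin n → List (Q.C × Fin n)),
        (∀ s : Fin n, (ordCol s).Nodup ∧ ∀ c : Q.C, c ∈ ordCol s ↔ s ∈ Q.mem c) →
        (∀ s : Fin n, (ordArr s).Nodup ∧
          ∀ cj : Q.C × Fin n, cj ∈ ordArr s ↔ Q.DArr cj.1 s cj.2) →
        ∃ ψ : Fission 𝕜 Q q ordCol ≃ₐ[𝕜] MPA 𝕜 Q q ordArr,
          ∀ i : Fin n, ψ (fissE 𝕜 Q q ordCol i) = mpaE 𝕜 Q q ordArr i := by
  choose lo hi hlt hmem hpart using hone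
  have hQ : IsOneArrow Q lo hi := ⟨hlt, hmem, hpart⟩
  refine ⟨exists_algEquiv_of_oneArrow hQ (fun _ _ h => h) (fun _ _ h => h)
    (respects_boalchOfVdB hQ (respects_gen _)) (respects_vdBOfBoalch hQ (respects_gen _)), ?_⟩
  intro q ordCol ordArr hC hA
  obtain ⟨ψ, hψ⟩ := exists_fission_algEquiv_mpa hQ q ordArr (fun s cj h => ((hA s).2 cj).1 h)
  have hperm (s : Fin n) : (ordCol s).Perm ((ordArr s).map Prod.fst) := by
    have hnd : ((ordArr s).map Prod.fst).Nodup := by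
      refine (hA s).1.map_on ?_
      rintro ⟨c, j⟩ h ⟨c', j'⟩ h' (rfl : c = c')
      rw [(hA s).2, hQ.dArr_iff] at h h'
      have := (hlt c).ne
      grind
    refine (List.perm_ext_iff_of_nodup (hC s).1 hnd).2 fun c => ?_
    have := (hlt c).ne
    simp only [(hC s).2, List.mem_map, (hA s).2, hQ.mem_iff, hQ.dArr_iff, Prod.exists]
    grind
  obtain ⟨χ, hχ⟩ := fissionIso_of_perm q (fun s => (hC s).1)
    (fun s c h => ((hC s).2 c).1 h) hperm
  exact ⟨χ.trans ψ, fun i => by rw [AlgEquiv.trans_apply, hχ, hψ]⟩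

end NCQP
end
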